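/- arXiv:2007.08580 — 6 statements merged into one kernel-verified Lean document; each statement's English description precedes it below -/
import Mathlib

section
/- The Landau damping rate of the Langmuir pole is strictly positive and vanishes to infinite order at k = 0 (Lemma 2.5, estimates (2.16)): If p : [0,ν₀) → ℂ is a pole branch, then there exists ν₁ ∈ (0, ν₀] such that Re p(κ) < 0 for all κ ∈ (0, ν₁), and for every N ∈ ℕ there exists C_N > 0 such that |Re p(κ)| ≤ C_N·κ^N for all κ ∈ (0, ν₁). -/
open MeasureTheory Complex

/-- The Fourier transform of the Maxwellian along a fixed direction:
`F(s) = n₀ · exp(−β s²/2)`. -/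
noncomputable def Fmax (n₀ β : ℝ) (s : ℝ) : ℝ := n₀ * Real.exp (-β * s ^ 2 / 2)

/-- The plasma dispersion function
`𝓛(z,κ) = −(w₀/κ²) ∫₀^∞ s F(s) exp(−(z/κ) s) ds` with `w₀ = ωp²/n₀`. -/
noncomputable def disp (n₀ β ωp : ℝ) (z : ℂ) (κ : ℝ) : ℂ :=
  -(((ωp ^ 2 / n₀ : ℝ) : ℂ) / (κ : ℂ) ^ 2) *
    ∫ s in Set.Ioi (0 : ℝ),
      ((s : ℝ) : ℂ) * ((Fmax n₀ β s : ℝ) : ℂ) * Complex.exp (-(z / (κ : ℂ)) * ((s : ℝ) : ℂ))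

noncomputable def LDg (β : ℝ) (n : ℕ) (ζ : ℂ) (s : ℝ) : ℂ :=
  (s : ℂ) ^ n * Complex.exp (-((β / 2 : ℝ) : ℂ) * (s : ℂ) ^ 2 + (-ζ) * (s : ℂ))

noncomputable def LDJ (β : ℝ) (n : ℕ) (ζ : ℂ) : ℂ := ∫ s in Set.Ioi (0 : ℝ), LDg β n ζ s

lemma LDg_cont (β : ℝ) (n : ℕ) (ζ : ℂ) : Continuous (LDg β n ζ) := by
  unfold LDg; fun_prop

lemma LDg_norm (β : ℝ) (n : ℕ) (ζ : ℂ) (s : ℝ) (hs : 0 < s) :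
    ‖LDg β n ζ s‖ = s ^ n * Real.exp (-(β / 2) * s ^ 2 - ζ.re * s) := by
  unfold LDg
  rw [norm_mul, norm_pow, Complex.norm_real, Real.norm_of_nonneg hs.le, Complex.norm_exp]
  congr 2
  have h1 : ((s : ℂ) ^ 2) = ((s ^ 2 : ℝ) : ℂ) := by push_cast; rfl
  rw [h1, ← Complex.ofReal_neg, ← Complex.ofReal_mul, Complex.add_re, Complex.ofReal_re,
    Complex.re_mul_ofReal, Complex.neg_re]
  ring

lemma LDg_int (β : ℝ) (hβ : 0 < β) (n : ℕ) (ζ : ℂ) :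
    IntegrableOn (LDg β n ζ) (Set.Ioi 0) := by
  have h0 := (integrable_cexp_quadratic (b := ((β / 2 : ℝ) : ℂ))
    (by rw [Complex.ofReal_re]; positivity) (1 - ζ) 0).norm.const_mul (n.factorial : ℝ)
  refine Integrable.mono' h0.integrableOn (LDg_cont β n ζ).aestronglyMeasurable ?_
  refine (ae_restrict_mem measurableSet_Ioi).mono fun s hs => ?_
  have hs : 0 < s := hs
  have e : Complex.exp (-((β / 2 : ℝ) : ℂ) * (s : ℂ) ^ 2 + (1 - ζ) * (s : ℂ) + 0)
      = LDg β 0 (ζ - 1) s := by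
    unfold LDg; rw [pow_zero, one_mul]; congr 1; ring
  rw [e, LDg_norm _ _ _ _ hs, LDg_norm _ _ _ _ hs, pow_zero, one_mul]
  have h2 := Real.pow_div_factorial_le_exp s hs.le n
  rw [div_le_iff₀ (by positivity)] at h2
  have h3 : Real.exp (-(β / 2) * s ^ 2 - (ζ - 1).re * s)
      = Real.exp s * Real.exp (-(β / 2) * s ^ 2 - ζ.re * s) := by
    rw [← Real.exp_add]; congr 1; simp; ring
  rw [h3]
  calc _ ≤ (Real.exp s * n.factorial) * Real.exp (-(β / 2) * s ^ 2 - ζ.re * s) := by gcongr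
    _ = _ := by ring

lemma LDJ_bdd (β : ℝ) (hβ : 0 < β) (n : ℕ) :
    ∃ C : ℝ, ∀ ζ : ℂ, 0 ≤ ζ.re → ‖LDJ β n ζ‖ ≤ C := by
  refine ⟨∫ s in Set.Ioi (0:ℝ), ‖LDg β n 0 s‖, fun ζ hζ => ?_⟩
  refine norm_integral_le_of_norm_le (LDg_int β hβ n 0).norm ?_
  refine (ae_restrict_mem measurableSet_Ioi).mono fun s hs => ?_
  have hs : 0 < s := hs
  rw [LDg_norm _ _ _ _ hs, LDg_norm _ _ _ _ hs]
  have : 0 ≤ ζ.re * s := by positivity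
  refine mul_le_mul_of_nonneg_left (Real.exp_le_exp.mpr ?_) (by positivity)
  rw [Complex.zero_re]; linarith

lemma LDg_deriv0 (β : ℝ) (ζ : ℂ) (s : ℝ) :
    HasDerivAt (LDg β 0 ζ) (-(β : ℂ) * LDg β 1 ζ s - ζ * LDg β 0 ζ s) s := by
  have h1 : HasDerivAt (fun z : ℂ => Complex.exp (-((β / 2 : ℝ) : ℂ) * z ^ 2 + (-ζ) * z))
      (Complex.exp (-((β / 2 : ℝ) : ℂ) * (s : ℂ) ^ 2 + (-ζ) * (s : ℂ)) *
        (-((β / 2 : ℝ) : ℂ) * (2 * (s : ℂ)) + (-ζ))) (s : ℂ) := by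
    have := (((hasDerivAt_id (s : ℂ)).pow 2).const_mul (-((β / 2 : ℝ) : ℂ))).add
      ((hasDerivAt_id (s : ℂ)).const_mul (-ζ))
    refine this.cexp.congr_deriv ?_
    simp
  have h2 := h1.comp_ofReal
  have e : LDg β 0 ζ = fun y : ℝ => Complex.exp (-((β / 2 : ℝ) : ℂ) * (y : ℂ) ^ 2 + (-ζ) * (y : ℂ)) := by
    funext y; unfold LDg; simp
  rw [e]
  convert h2 using 1
  unfold LDg
  push_cast
  ring

lemma LDg_derivS (β : ℝ) (n : ℕ) (ζ : ℂ) (s : ℝ) :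
    HasDerivAt (LDg β (n + 1) ζ)
      ((n + 1 : ℂ) * LDg β n ζ s - (β : ℂ) * LDg β (n + 2) ζ s - ζ * LDg β (n + 1) ζ s) s := by
  have h1 : HasDerivAt (fun y : ℝ => (y : ℂ) ^ (n + 1)) ((n + 1 : ℂ) * (s : ℂ) ^ n) s := by
    have := (hasDerivAt_pow (n + 1) (s : ℂ)).comp_ofReal
    simpa using this
  have h2 := h1.mul (LDg_deriv0 β ζ s)
  have e : LDg β (n + 1) ζ = (fun y : ℝ => (y : ℂ) ^ (n + 1)) * LDg β 0 ζ := by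
    funext y; simp [LDg]
  rw [e]
  refine h2.congr_deriv ?_
  unfold LDg
  simp
  ring

lemma LDJ_rec0 (β : ℝ) (hβ : 0 < β) (ζ : ℂ) :
    ζ * LDJ β 0 ζ = 1 - β * LDJ β 1 ζ := by
  have i0 := LDg_int β hβ 0 ζ
  have i1 := LDg_int β hβ 1 ζ
  have id' : IntegrableOn (fun s => -(β : ℂ) * LDg β 1 ζ s - ζ * LDg β 0 ζ s) (Set.Ioi 0) :=
    (i1.const_mul _).sub (i0.const_mul _)
  have ht := tendsto_zero_of_hasDerivAt_of_integrableOn_Ioi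
    (fun s _ => LDg_deriv0 β ζ s) id' i0
  have h := integral_Ioi_of_hasDerivAt_of_tendsto' (a := 0)
    (fun s _ => LDg_deriv0 β ζ s) id' ht
  rw [integral_sub (i1.const_mul _) (i0.const_mul _), integral_const_mul, integral_const_mul] at h
  have e0 : LDg β 0 ζ 0 = 1 := by simp [LDg]
  rw [e0] at h
  change -(β : ℂ) * LDJ β 1 ζ - ζ * LDJ β 0 ζ = 0 - 1 at h
  linear_combination -h

lemma LDJ_recS (β : ℝ) (hβ : 0 < β) (n : ℕ) (ζ : ℂ) :
    ζ * LDJ β (n + 1) ζ = (n + 1) * LDJ β n ζ - β * LDJ β (n + 2) ζ := by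
  have i0 := LDg_int β hβ n ζ
  have i1 := LDg_int β hβ (n + 1) ζ
  have i2 := LDg_int β hβ (n + 2) ζ
  have i02 : IntegrableOn (fun s => (n + 1 : ℂ) * LDg β n ζ s - (β : ℂ) * LDg β (n + 2) ζ s)
      (Set.Ioi 0) := (i0.const_mul _).sub (i2.const_mul _)
  have id' : IntegrableOn (fun s => (n + 1 : ℂ) * LDg β n ζ s - (β : ℂ) * LDg β (n + 2) ζ s
      - ζ * LDg β (n + 1) ζ s) (Set.Ioi 0) := i02.sub (i1.const_mul _)
  have ht := tendsto_zero_of_hasDerivAt_of_integrableOn_Ioi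
    (fun s _ => LDg_derivS β n ζ s) id' i1
  have h := integral_Ioi_of_hasDerivAt_of_tendsto' (a := 0)
    (fun s _ => LDg_derivS β n ζ s) id' ht
  rw [integral_sub i02 (i1.const_mul _), integral_sub (i0.const_mul _) (i2.const_mul _),
    integral_const_mul, integral_const_mul, integral_const_mul] at h
  have e0 : LDg β (n + 1) ζ 0 = 0 := by simp [LDg]
  rw [e0] at h
  change (n + 1 : ℂ) * LDJ β n ζ - (β : ℂ) * LDJ β (n + 2) ζ - ζ * LDJ β (n + 1) ζ = 0 - 0 at h
  linear_combination -h

lemma LDJ_decay (β : ℝ) (hβ : 0 < β) (k : ℕ) : ∀ n : ℕ, k ≤ n + 1 →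
    ∃ C : ℝ, ∀ ζ : ℂ, 0 ≤ ζ.re → ‖LDJ β n ζ‖ * ‖ζ‖ ^ k ≤ C := by
  induction k with
  | zero => intro n _; simpa using LDJ_bdd β hβ n
  | succ k ih =>
    intro n hn
    cases n with
    | zero =>
      obtain rfl : k = 0 := by omega
      obtain ⟨C, hC⟩ := LDJ_bdd β hβ 1
      refine ⟨1 + β * C, fun ζ hζ => ?_⟩
      have : ‖LDJ β 0 ζ‖ * ‖ζ‖ ^ (0 + 1) = ‖1 - β * LDJ β 1 ζ‖ := by
        rw [← LDJ_rec0 β hβ ζ, norm_mul]; ring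
      rw [this]
      refine (norm_sub_le _ _).trans ?_
      rw [norm_mul, Complex.norm_real, Real.norm_of_nonneg hβ.le, norm_one]
      have := hC ζ hζ
      gcongr
    | succ n =>
      obtain ⟨C, hC⟩ := ih n (by omega)
      obtain ⟨D, hD⟩ := ih (n + 2) (by omega)
      refine ⟨(n + 1) * C + β * D, fun ζ hζ => ?_⟩
      have : ‖LDJ β (n + 1) ζ‖ * ‖ζ‖ ^ (k + 1) =
          ‖(n + 1) * LDJ β n ζ - β * LDJ β (n + 2) ζ‖ * ‖ζ‖ ^ k := by
        rw [← LDJ_recS β hβ n ζ, norm_mul]; ring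
      rw [this]
      have h1 : ‖(n + 1) * LDJ β n ζ - β * LDJ β (n + 2) ζ‖ ≤
          (n + 1) * ‖LDJ β n ζ‖ + β * ‖LDJ β (n + 2) ζ‖ := by
        refine (norm_sub_le _ _).trans ?_
        rw [norm_mul, norm_mul, Complex.norm_real, Real.norm_of_nonneg hβ.le]
        have : ‖(n + 1 : ℂ)‖ = n + 1 := by
          rw [← Nat.cast_succ, Complex.norm_natCast]; push_cast; rfl
        rw [this]
      have c1 := hC ζ hζ
      have c2 := hD ζ hζ
      calc _ ≤ ((n + 1) * ‖LDJ β n ζ‖ + β * ‖LDJ β (n + 2) ζ‖) * ‖ζ‖ ^ k := by gcongr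
        _ = (n + 1) * (‖LDJ β n ζ‖ * ‖ζ‖ ^ k) + β * (‖LDJ β (n + 2) ζ‖ * ‖ζ‖ ^ k) := by ring
        _ ≤ _ := by gcongr

lemma LDJ2_asymp (β : ℝ) (hβ : 0 < β) :
    ∃ C : ℝ, ∀ ζ : ℂ, 0 ≤ ζ.re → ‖ζ ^ 3 * LDJ β 2 ζ - 2‖ * ‖ζ‖ ≤ C := by
  obtain ⟨C1, h1⟩ := LDJ_decay β hβ 1 1 (by omega)
  obtain ⟨C2, h2⟩ := LDJ_decay β hβ 2 2 (by omega)
  obtain ⟨C3, h3⟩ := LDJ_decay β hβ 3 3 (by omega)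
  refine ⟨2 * β * C1 + 2 * β * C2 + β * C3, fun ζ hζ => ?_⟩
  have e : ζ ^ 3 * LDJ β 2 ζ - 2 = -(2 * β * LDJ β 1 ζ + 2 * β * (LDJ β 2 ζ * ζ)
      + β * (LDJ β 3 ζ * ζ ^ 2)) := by
    have r0 := LDJ_rec0 β hβ ζ
    have r1 := LDJ_recS β hβ 0 ζ
    have r2 := LDJ_recS β hβ 1 ζ
    norm_num at r1 r2
    linear_combination ζ ^ 2 * r2 + 2 * ζ * r1 + 2 * r0
  have e2 : ‖ζ ^ 3 * LDJ β 2 ζ - 2‖ ≤ 2 * β * ‖LDJ β 1 ζ‖ + 2 * β * (‖LDJ β 2 ζ‖ * ‖ζ‖)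
      + β * (‖LDJ β 3 ζ‖ * ‖ζ‖ ^ 2) := by
    rw [e, norm_neg]
    refine (norm_add₃_le).trans ?_
    simp [abs_of_pos hβ]
  have c1 := h1 ζ hζ
  have c2 := h2 ζ hζ
  have c3 := h3 ζ hζ
  calc _ ≤ (2 * β * ‖LDJ β 1 ζ‖ + 2 * β * (‖LDJ β 2 ζ‖ * ‖ζ‖)
      + β * (‖LDJ β 3 ζ‖ * ‖ζ‖ ^ 2)) * ‖ζ‖ := by gcongr
    _ = 2 * β * (‖LDJ β 1 ζ‖ * ‖ζ‖ ^ 1) + 2 * β * (‖LDJ β 2 ζ‖ * ‖ζ‖ ^ 2)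
      + β * (‖LDJ β 3 ζ‖ * ‖ζ‖ ^ 3) := by ring
    _ ≤ _ := by gcongr

lemma LDJ_hasDeriv (β : ℝ) (hβ : 0 < β) (n : ℕ) (ζ : ℂ) :
    HasDerivAt (LDJ β n) (-LDJ β (n + 1) ζ) ζ := by
  have := (hasDerivAt_integral_of_dominated_loc_of_deriv_le
    (μ := volume.restrict (Set.Ioi (0:ℝ))) (𝕜 := ℂ)
    (F := fun z s => LDg β n z s) (F' := fun z s => - LDg β (n + 1) z s)
    (bound := fun s => ‖LDg β (n + 1) (ζ - 1) s‖) (x₀ := ζ)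
    (Metric.ball_mem_nhds ζ one_pos)
    (Filter.Eventually.of_forall fun z => (LDg_cont β n z).aestronglyMeasurable)
    (LDg_int β hβ n ζ) (LDg_cont β (n + 1) ζ).neg.aestronglyMeasurable
    ?_ (LDg_int β hβ (n + 1) (ζ - 1)).norm ?_).2
  · rw [integral_neg] at this
    exact this
  · refine (ae_restrict_mem measurableSet_Ioi).mono fun s hs z hz => ?_
    have hs : 0 < s := hs
    rw [norm_neg, LDg_norm _ _ _ _ hs, LDg_norm _ _ _ _ hs]
    have h1 : |(z - ζ).re| ≤ 1 :=
      (Complex.abs_re_le_norm _).trans (by rw [Metric.mem_ball, dist_eq_norm] at hz; exact hz.le)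
    have h2 : (ζ - 1).re ≤ z.re := by
      have := (abs_le.mp h1).1
      simp at this ⊢; linarith
    gcongr
  · refine Filter.Eventually.of_forall fun s z _ => ?_
    have := ((((hasDerivAt_id z).neg.mul_const (s : ℂ)).const_add
      (-((β / 2 : ℝ) : ℂ) * (s : ℂ) ^ 2)).cexp).const_mul ((s : ℂ) ^ n)
    refine this.congr_deriv ?_
    unfold LDg
    simp
    ring

noncomputable def LDK (β : ℝ) : ℝ := (Real.pi / (β / 2)) ^ (1 / 2 : ℝ)

lemma LDK_pos (β : ℝ) (hβ : 0 < β) : 0 < LDK β := by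
  unfold LDK; have := Real.pi_pos; positivity

lemma LDJ_refl0 (β : ℝ) (hβ : 0 < β) (ζ : ℂ) :
    LDJ β 0 ζ + LDJ β 0 (-ζ) = LDK β * Complex.exp (ζ ^ 2 / (2 * β)) := by
  have hb : (-((β / 2 : ℝ) : ℂ)).re < 0 := by
    rw [Complex.neg_re, Complex.ofReal_re]; linarith
  have h := integral_cexp_quadratic hb (-ζ) 0
  have hi := integrable_cexp_quadratic' hb (-ζ) 0
  rw [← intervalIntegral.integral_Iic_add_Ioi (b := 0) hi.integrableOn hi.integrableOn] at h
  have h1 := integral_comp_neg_Ioi 0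
    (fun x : ℝ => Complex.exp (-((β / 2 : ℝ) : ℂ) * (x : ℂ) ^ 2 + (-ζ) * (x : ℂ) + 0))
  rw [neg_zero] at h1
  rw [← h1] at h
  have e1 : LDJ β 0 (-ζ) = ∫ x in Set.Ioi (0:ℝ), Complex.exp (-((β / 2 : ℝ) : ℂ) *
      ((-x : ℝ) : ℂ) ^ 2 + (-ζ) * ((-x : ℝ) : ℂ) + 0) := by
    unfold LDJ LDg
    congr 1; funext x; rw [pow_zero, one_mul]; congr 1; push_cast; ring
  have e2 : LDJ β 0 ζ = ∫ x in Set.Ioi (0:ℝ), Complex.exp (-((β / 2 : ℝ) : ℂ) *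
      (x : ℂ) ^ 2 + (-ζ) * (x : ℂ) + 0) := by
    unfold LDJ LDg
    congr 1; funext x; rw [pow_zero, one_mul, add_zero]
  rw [add_comm, e1, e2, h]
  congr 1
  · rw [neg_neg, LDK, Complex.ofReal_cpow (by have := Real.pi_pos; positivity)]
    push_cast; rfl
  · congr 1
    have : (β : ℂ) ≠ 0 := by exact_mod_cast hβ.ne'
    push_cast
    field_simp
    ring

lemma LDJ_refl1 (β : ℝ) (hβ : 0 < β) (ζ : ℂ) :
    LDJ β 1 ζ - LDJ β 1 (-ζ) = -(ζ / β) * (LDK β * Complex.exp (ζ ^ 2 / (2 * β))) := by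
  rw [← LDJ_refl0 β hβ]
  have hb : (β : ℂ) ≠ 0 := by exact_mod_cast hβ.ne'
  have r1 := LDJ_rec0 β hβ ζ
  have r2 := LDJ_rec0 β hβ (-ζ)
  field_simp
  linear_combination r1 - r2

lemma LDJ_conj (β : ℝ) (n : ℕ) (ζ : ℂ) :
    LDJ β n ((starRingEnd ℂ) ζ) = (starRingEnd ℂ) (LDJ β n ζ) := by
  unfold LDJ
  rw [← integral_conj]
  congr 1; funext s
  unfold LDg
  rw [map_mul, map_pow, Complex.conj_ofReal, ← Complex.exp_conj, map_add, map_mul, map_mul,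
    map_neg, map_neg, map_pow, Complex.conj_ofReal, Complex.conj_ofReal]

lemma LDJ1_axis (β : ℝ) (hβ : 0 < β) (y : ℝ) :
    (LDJ β 1 (y * I)).im = -(y / (2 * β)) * LDK β * Real.exp (-(y ^ 2 / (2 * β))) := by
  have h := LDJ_refl1 β hβ (y * I)
  have e : -((y : ℂ) * I) = (starRingEnd ℂ) (y * I) := by simp
  rw [e, LDJ_conj] at h
  have e2 : ((y : ℂ) * I) ^ 2 / (2 * β) = ((-(y ^ 2 / (2 * β)) : ℝ) : ℂ) := by
    rw [mul_pow, I_sq]; push_cast; ring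
  have e3 : -((y : ℂ) * I / β) * (LDK β * Complex.exp (((y : ℂ) * I) ^ 2 / (2 * β)))
      = ((-(y / β) * LDK β * Real.exp (-(y ^ 2 / (2 * β))) : ℝ) : ℂ) * I := by
    rw [e2]; push_cast; ring
  rw [e3] at h
  have := congrArg Complex.im h
  rw [Complex.sub_im, Complex.conj_im, Complex.im_ofReal_mul, Complex.I_im] at this
  have hb := hβ.ne'
  field_simp at this ⊢
  linarith

lemma LDJ2_im (β : ℝ) (hβ : 0 < β) :
    ∃ Y : ℝ, 1 ≤ Y ∧ ∀ y t : ℝ, Y ≤ y → 0 ≤ t → t ≤ y / 4 →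
      1 / (4 * y ^ 3) ≤ (LDJ β 2 (t + y * I)).im := by
  obtain ⟨C, hC⟩ := LDJ2_asymp β hβ
  refine ⟨max 1 C, le_max_left _ _, fun y t hy ht hty => ?_⟩
  have hy1 : 1 ≤ y := (le_max_left _ _).trans hy
  have hyC : C ≤ y := (le_max_right _ _).trans hy
  set ζ : ℂ := t + y * I with hζ
  have hre : ζ.re = t := by simp [hζ]
  have him : ζ.im = y := by simp [hζ]
  have hyn : y ≤ ‖ζ‖ := by
    have := Complex.abs_im_le_norm ζ
    rw [him] at this; exact (le_abs_self _).trans this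
  have hsq : ‖ζ‖ ^ 2 = t ^ 2 + y ^ 2 := by
    rw [← Complex.normSq_eq_norm_sq, Complex.normSq_apply, hre, him]; ring
  have h1 := hC ζ (by rw [hre]; exact ht)
  set δ := ζ ^ 3 * LDJ β 2 ζ - 2 with hδ
  have hδ1 : ‖δ‖ ≤ 1 := by
    by_contra hcon
    push Not at hcon
    nlinarith
  set c := (starRingEnd ℂ) ζ with hc
  have hcζ : c * ζ = ((‖ζ‖ ^ 2 : ℝ) : ℂ) := by
    rw [hc, mul_comm, Complex.mul_conj, Complex.normSq_eq_norm_sq]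
  have key : (((‖ζ‖ ^ 2) ^ 3 : ℝ) : ℂ) * LDJ β 2 ζ = c ^ 3 * 2 + c ^ 3 * δ := by
    have : (((‖ζ‖ ^ 2) ^ 3 : ℝ) : ℂ) = (c * ζ) ^ 3 := by rw [hcζ]; push_cast; rfl
    rw [this, hδ]; ring
  have him2 := congrArg Complex.im key
  rw [Complex.im_ofReal_mul, Complex.add_im] at him2
  have hc3 : (c ^ 3 * 2).im = 2 * (y ^ 3 - 3 * t ^ 2 * y) := by
    have : c = t - y * I := by simp [hc, hζ, sub_eq_add_neg]
    have e : c ^ 3 * 2 = ((2 * (t ^ 3 - 3 * t * y ^ 2) : ℝ) : ℂ)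
        + ((2 * (y ^ 3 - 3 * t ^ 2 * y) : ℝ) : ℂ) * I := by
      rw [this]; push_cast
      have := I_sq
      linear_combination (6 * (t:ℂ) * y ^ 2 - 2 * (y:ℂ) ^ 3 * I) * this
    rw [e, Complex.add_im, Complex.ofReal_im, Complex.im_ofReal_mul, Complex.I_im]; ring
  have hd : -‖ζ‖ ^ 3 ≤ (c ^ 3 * δ).im := by
    have h := Complex.abs_im_le_norm (c ^ 3 * δ)
    rw [norm_mul, norm_pow, hc, Complex.norm_conj] at h
    have h5 : ‖ζ‖ ^ 3 * ‖δ‖ ≤ ‖ζ‖ ^ 3 * 1 := by gcongr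
    have := (abs_le.mp h).1
    linarith
  have ht2 : t ^ 2 ≤ y ^ 2 / 16 := by nlinarith
  have hn : ‖ζ‖ ≤ 33 / 32 * y := by
    refine abs_le_of_sq_le_sq' ?_ (by positivity) |>.2
    rw [hsq]; nlinarith [sq_nonneg y]
  have hn3 : ‖ζ‖ ^ 3 ≤ (33 / 32 * y) ^ 3 := by gcongr
  have hn6 : (‖ζ‖ ^ 2) ^ 3 ≤ ((33 / 32 * y) ^ 2) ^ 3 := by gcongr
  have hn6p : 0 < (‖ζ‖ ^ 2) ^ 3 := by
    have : 0 < ‖ζ‖ := by linarith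
    positivity
  have hy3 : 0 < y ^ 3 := by positivity
  have hA : y ^ 3 / 2 ≤ (‖ζ‖ ^ 2) ^ 3 * (LDJ β 2 ζ).im := by
    rw [him2, hc3]
    have : t ^ 2 * y ≤ y ^ 2 / 16 * y := by gcongr
    have e : (33 / 32 * y) ^ 3 = (33 / 32) ^ 3 * y ^ 3 := by ring
    rw [e] at hn3
    nlinarith
  have hpos : 0 < (LDJ β 2 ζ).im := by
    by_contra hcon
    push Not at hcon
    nlinarith
  rw [div_le_iff₀ (by positivity)]
  have hB : y ^ 3 / 2 ≤ ((33 / 32 * y) ^ 2) ^ 3 * (LDJ β 2 ζ).im := hA.trans (by gcongr)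
  have e : ((33 / 32 * y) ^ 2) ^ 3 * (LDJ β 2 ζ).im
      = y ^ 3 * ((33 / 32) ^ 6 * (y ^ 3 * (LDJ β 2 ζ).im)) := by ring
  have hB' : y ^ 3 * (1 / 2) ≤ y ^ 3 * ((33 / 32) ^ 6 * (y ^ 3 * (LDJ β 2 ζ).im)) := by
    rw [← e]; linarith
  have := le_of_mul_le_mul_left hB' hy3
  have hq : 0 < y ^ 3 * (LDJ β 2 ζ).im := by positivity
  nlinarith

lemma LDJ1_im (β : ℝ) (hβ : 0 < β) :
    ∃ Y : ℝ, 1 ≤ Y ∧ ∀ y a : ℝ, Y ≤ y → 0 ≤ a → a ≤ y / 4 →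
      (LDJ β 1 (a + y * I)).im < - (a / (4 * y ^ 3)) := by
  obtain ⟨Y, hY, h⟩ := LDJ2_im β hβ
  refine ⟨Y, hY, fun y a hy ha hay => ?_⟩
  have hy0 : 0 < y := by linarith
  have hd : ∀ t : ℝ, HasDerivAt (fun t : ℝ => (LDJ β 1 (t + y * I)).im)
      (-(LDJ β 2 (t + y * I)).im) t := by
    intro t
    have h1 : HasDerivAt (fun z : ℂ => LDJ β 1 (z + y * I)) (-LDJ β 2 (t + y * I)) (t : ℂ) :=
      (LDJ_hasDeriv β hβ 1 (t + y * I)).comp_add_const (t : ℂ) (y * I)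
    have h2 := h1.comp_ofReal
    have h3 := (Complex.imCLM.hasFDerivAt.comp_hasDerivAt t h2)
    exact h3
  have hm := Convex.image_sub_le_mul_sub_of_deriv_le (convex_Icc 0 (y / 4))
    (f := fun t : ℝ => (LDJ β 1 (t + y * I)).im)
    (fun t _ => (hd t).continuousAt.continuousWithinAt)
    (fun t _ => (hd t).differentiableAt.differentiableWithinAt)
    (C := -(1 / (4 * y ^ 3)))
    (fun t ht => by
      rw [(hd t).deriv]
      have ht' := interior_subset ht
      exact neg_le_neg (h y t hy ht'.1 ht'.2))
    0 ⟨le_rfl, by positivity⟩ a ⟨ha, hay⟩ ha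
  have h0 := LDJ1_axis β hβ y
  have hK := LDK_pos β hβ
  have hneg : 0 < (y / (2 * β)) * LDK β * Real.exp (-(y ^ 2 / (2 * β))) := by positivity
  simp only [Complex.ofReal_zero, zero_add, sub_zero] at hm
  rw [h0] at hm
  have : -(1 / (4 * y ^ 3)) * a = -(a / (4 * y ^ 3)) := by ring
  linarith

/-- Zeros of the imaginary part: damping, with an exponential bound. -/
lemma LD_zero (β : ℝ) (hβ : 0 < β) :
    ∃ Y : ℝ, 1 ≤ Y ∧ ∀ x y : ℝ, Y ≤ y → |x| ≤ y / 4 → (LDJ β 1 (x + y * I)).im = 0 →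
      x < 0 ∧ |x| ≤ 8 * LDK β / β * y ^ 4 * Real.exp (-(y ^ 2 / (4 * β))) := by
  obtain ⟨Y, hY, h⟩ := LDJ1_im β hβ
  refine ⟨Y, hY, fun x y hy hxy hz => ?_⟩
  have hy0 : 0 < y := by linarith
  have hx : x < 0 := by
    by_contra hx
    push Not at hx
    have h1 := h y x hy hx ((le_abs_self x).trans hxy)
    have : 0 ≤ x / (4 * y ^ 3) := by positivity
    linarith
  refine ⟨hx, ?_⟩
  set ζ : ℂ := x + y * I with hζ
  have h1 := h y |x| hy (abs_nonneg x) hxy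
  have e : ((|x| : ℝ) : ℂ) + y * I = (starRingEnd ℂ) (-ζ) := by
    rw [abs_of_neg hx, hζ]; simp; ring
  rw [e, LDJ_conj, Complex.conj_im] at h1
  have h2 := congrArg Complex.im (LDJ_refl1 β hβ ζ)
  rw [Complex.sub_im, hz] at h2
  have hE : ‖-(ζ / β) * (LDK β * Complex.exp (ζ ^ 2 / (2 * β)))‖ ≤
      2 * y / β * (LDK β * Real.exp (-(y ^ 2 / (4 * β)))) := by
    rw [norm_mul, norm_mul, norm_neg, norm_div, Complex.norm_real, Complex.norm_real,
      Real.norm_of_nonneg hβ.le, Real.norm_of_nonneg (LDK_pos β hβ).le, Complex.norm_exp]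
    have hK := LDK_pos β hβ
    have hn : ‖ζ‖ ≤ 2 * y := by
      rw [hζ]
      refine (norm_add_le _ _).trans ?_
      rw [norm_mul, Complex.norm_real, Complex.norm_real, Complex.norm_I, Real.norm_eq_abs,
        Real.norm_of_nonneg hy0.le]
      linarith
    have hr : (ζ ^ 2 / (2 * β)).re ≤ -(y ^ 2 / (4 * β)) := by
      have e : ζ ^ 2 / (2 * β) = (((x ^ 2 - y ^ 2) / (2 * β) : ℝ) : ℂ)
          + ((x * y / β : ℝ) : ℂ) * I := by
        have hb : (β : ℂ) ≠ 0 := by exact_mod_cast hβ.ne'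
        rw [hζ]; push_cast
        field_simp
        linear_combination (y : ℂ) ^ 2 * I_sq
      rw [e]
      have : ((((x ^ 2 - y ^ 2) / (2 * β) : ℝ) : ℂ) + ((x * y / β : ℝ) : ℂ) * I).re
        = (x ^ 2 - y ^ 2) / (2 * β) := by
        rw [Complex.add_re, Complex.ofReal_re, Complex.re_ofReal_mul, Complex.I_re]; ring
      rw [this, ← neg_div, div_le_div_iff₀ (by positivity) (by positivity)]
      have hx2 : x ^ 2 ≤ (y / 4) ^ 2 := sq_le_sq' (by linarith [neg_abs_le x]) (by linarith [le_abs_self x])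
      nlinarith
    gcongr
  have h3 := (Complex.abs_im_le_norm _).trans hE
  rw [← h2] at h3
  have h4 := (abs_le.mp h3).1
  have h5 : |x| / (4 * y ^ 3) ≤ 2 * y / β * (LDK β * Real.exp (-(y ^ 2 / (4 * β)))) := by
    have := (abs_le.mp h3).2
    simp at h1 h4 this
    linarith
  rw [div_le_iff₀ (by positivity)] at h5
  refine h5.trans (le_of_eq ?_)
  ring

lemma LD_pow_exp (c : ℝ) (hc : 0 < c) (n : ℕ) :
    ∃ C : ℝ, 0 < C ∧ ∀ y : ℝ, 1 ≤ y → y ^ n * Real.exp (-(c * y ^ 2)) ≤ C := by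
  refine ⟨n.factorial / c ^ n, by positivity, fun y hy => ?_⟩
  have h := Real.pow_div_factorial_le_exp (c * y ^ 2) (by positivity) n
  rw [div_le_iff₀ (by positivity), mul_pow] at h
  rw [Real.exp_neg, ← div_eq_mul_inv, div_le_div_iff₀ (Real.exp_pos _) (by positivity)]
  have : y ^ n ≤ (y ^ 2) ^ n := by
    have : y ≤ y ^ 2 := by nlinarith
    gcongr
  calc y ^ n * c ^ n ≤ (y ^ 2) ^ n * c ^ n := by gcongr
    _ ≤ _ := by linarith

lemma LD_disp (n₀ β ωp : ℝ) (hn : 0 < n₀) (hω : 0 < ωp) (z : ℂ) (κ : ℝ) (hκ : 0 < κ)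
    (h : disp n₀ β ωp z κ = 1) : (LDJ β 1 (z / κ)).im = 0 := by
  have e : (∫ s in Set.Ioi (0 : ℝ),
      ((s : ℝ) : ℂ) * ((Fmax n₀ β s : ℝ) : ℂ) * Complex.exp (-(z / (κ : ℂ)) * ((s : ℝ) : ℂ)))
      = n₀ * LDJ β 1 (z / κ) := by
    unfold LDJ
    rw [← integral_const_mul]
    congr 1; funext s
    unfold LDg Fmax
    rw [Complex.exp_add, pow_one]
    push_cast
    have : -(β : ℂ) * s ^ 2 / 2 = -((β : ℂ) / 2) * s ^ 2 := by ring
    rw [this]; ring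
  unfold disp at h
  rw [e] at h
  have hn' : (n₀ : ℂ) ≠ 0 := by exact_mod_cast hn.ne'
  have hω' : (ωp : ℂ) ≠ 0 := by exact_mod_cast hω.ne'
  have hκ' : (κ : ℂ) ≠ 0 := by exact_mod_cast hκ.ne'
  have : LDJ β 1 (z / κ) = ((-(κ ^ 2 / ωp ^ 2) : ℝ) : ℂ) := by
    push_cast at h ⊢
    field_simp at h ⊢
    linear_combination -h
  rw [this, Complex.ofReal_im]

/-- **The Landau damping rate of the Langmuir pole is strictly positive and vanishes to
infinite order at `k = 0`** (Lemma 2.5, estimates (2.16)). -/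
theorem landau_damping_rate_positive_and_flat
    (n₀ β ωp : ℝ) (hn : 0 < n₀) (hβ : 0 < β) (hω : 0 < ωp)
    (ν₀ : ℝ) (hν₀ : 0 < ν₀) (p : ℝ → ℂ)
    (hpc : ContinuousOn p (Set.Ico 0 ν₀))
    (hp0 : p 0 = Complex.I * (ωp : ℂ))
    (hpole : ∀ κ ∈ Set.Ioo (0:ℝ) ν₀, disp n₀ β ωp (p κ) κ = 1) :
    ∃ ν₁ ∈ Set.Ioc (0:ℝ) ν₀,
      (∀ κ ∈ Set.Ioo (0:ℝ) ν₁, (p κ).re < 0) ∧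
      (∀ N : ℕ, ∃ C > (0:ℝ), ∀ κ ∈ Set.Ioo (0:ℝ) ν₁, |(p κ).re| ≤ C * κ ^ N) := by
  obtain ⟨Y, hY, hz⟩ := LD_zero β hβ
  have hY0 : 0 < Y := by linarith
  have hc := Metric.continuousWithinAt_iff.mp (hpc 0 ⟨le_rfl, hν₀⟩) (ωp / 8) (by positivity)
  obtain ⟨d, hd, hpd⟩ := hc
  set ν₁ := min (min ν₀ d) (min 1 (ωp / (2 * Y))) with hν₁
  have hν₁pos : 0 < ν₁ := by
    refine lt_min (lt_min hν₀ hd) (lt_min one_pos (by positivity))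
  have main : ∀ κ ∈ Set.Ioo (0:ℝ) ν₁, κ ≤ 1 ∧ Y ≤ (p κ).im / κ ∧ ωp / 2 ≤ (p κ).im ∧
      (p κ).re / κ < 0 ∧ |(p κ).re / κ| ≤ 8 * LDK β / β * ((p κ).im / κ) ^ 4 *
        Real.exp (-(((p κ).im / κ) ^ 2 / (4 * β))) := by
    rintro κ ⟨h0, h1⟩
    have k1 : κ < ν₀ := h1.trans_le ((min_le_left _ _).trans (min_le_left _ _))
    have k2 : κ < d := h1.trans_le ((min_le_left _ _).trans (min_le_right _ _))
    have k3 : κ < 1 := h1.trans_le ((min_le_right _ _).trans (min_le_left _ _))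
    have k4 : κ < ωp / (2 * Y) := h1.trans_le ((min_le_right _ _).trans (min_le_right _ _))
    have hk := hpd (x := κ) ⟨h0.le, k1⟩ (by rw [Real.dist_eq, sub_zero, abs_of_pos h0]; exact k2)
    rw [hp0, dist_eq_norm] at hk
    have hre := (Complex.abs_re_le_norm _).trans hk.le
    have him := (Complex.abs_im_le_norm _).trans hk.le
    simp at hre him
    have him1 := (abs_le.mp him).1
    have hi2 : ωp / 2 ≤ (p κ).im := by linarith
    have hYy : Y ≤ (p κ).im / κ := by
      rw [le_div_iff₀ h0]
      rw [lt_div_iff₀ (by positivity)] at k4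
      linarith
    have e : p κ / κ = (((p κ).re / κ : ℝ) : ℂ) + (((p κ).im / κ : ℝ) : ℂ) * I := by
      conv_lhs => rw [← Complex.re_add_im (p κ)]
      push_cast; ring
    have hzero := LD_disp n₀ β ωp hn hω (p κ) κ h0 (hpole κ ⟨h0, k1⟩)
    rw [e] at hzero
    have := hz _ _ hYy (by
      rw [abs_div, abs_of_pos h0, div_right_comm]
      gcongr; linarith) hzero
    exact ⟨k3.le, hYy, hi2, this.1, this.2⟩
  refine ⟨ν₁, ⟨hν₁pos, (min_le_left _ _).trans (min_le_left _ _)⟩, fun κ hκ => ?_, fun N => ?_⟩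
  · have := (main κ hκ).2.2.2.1
    rcases div_neg_iff.mp this with h | h
    · linarith [hκ.1, h.2]
    · exact h.1
  · obtain ⟨C, hC, hpe⟩ := LD_pow_exp (1 / (4 * β)) (by positivity) (4 + N)
    have hK := LDK_pos β hβ
    refine ⟨8 * LDK β / β * C * (2 / ωp) ^ N, by positivity, fun κ hκ => ?_⟩
    obtain ⟨k1, hYy, hi2, -, hb⟩ := main κ hκ
    have h0 : 0 < κ := hκ.1
    set y := (p κ).im / κ with hy
    have hy1 : 1 ≤ y := hY.trans hYy
    have hy0 : 0 < y := by linarith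
    have h1 := hpe y hy1
    have e1 : y ^ 4 * Real.exp (-(y ^ 2 / (4 * β))) ≤ C * (1 / y) ^ N := by
      rw [one_div, inv_pow, ← div_eq_mul_inv, le_div_iff₀ (by positivity)]
      refine le_trans (le_of_eq ?_) h1
      have : 1 / (4 * β) * y ^ 2 = y ^ 2 / (4 * β) := by ring
      rw [this]; ring
    have e2 : 1 / y ≤ 2 / ωp * κ := by
      rw [hy, one_div_div, div_mul_eq_mul_div, div_le_div_iff₀ (by linarith) hω]
      nlinarith
    have e3 : |(p κ).re| = κ * |(p κ).re / κ| := by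
      rw [abs_div, abs_of_pos h0]; field_simp
    rw [e3]
    calc κ * |(p κ).re / κ| ≤ 1 * |(p κ).re / κ| := by gcongr
      _ ≤ 8 * LDK β / β * (y ^ 4 * Real.exp (-(y ^ 2 / (4 * β)))) := by
        rw [one_mul]; refine hb.trans (le_of_eq ?_); ring
      _ ≤ 8 * LDK β / β * (C * (2 / ωp * κ) ^ N) := by
        have : (1 / y) ^ N ≤ (2 / ωp * κ) ^ N := by gcongr
        exact mul_le_mul_of_nonneg_left (e1.trans (by gcongr)) (by positivity)
      _ = _ := by rw [mul_pow]; ring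
end

section
/- Quadratic decay of the dispersion function along vertical lines (Lemma 2.1, inequality (2.5)): For every λ ∈ ℝ there exists C > 0 such that for all κ > 0 and all ω ∈ ℝ with λ²κ² + ω² > 0, one has |𝓛(λ·κ + i·ω, κ)| ≤ C/(λ²·κ² + ω²). -/
open MeasureTheory Complex

/-- Gaussian times exponential. -/
noncomputable def gE (β : ℝ) (ζ : ℂ) (s : ℝ) : ℂ :=
  Complex.exp (-(β : ℂ) * (s : ℂ) ^ 2 / 2 - ζ * (s : ℂ))

lemma gE_bound (β : ℝ) (hβ : 0 < β) (ζ : ℂ) (n : ℕ) (s : ℝ) (hs : 0 ≤ s) :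
    ‖(s : ℂ) ^ n * gE β ζ s‖
      ≤ (n.factorial * Real.exp ((2 - ζ.re) ^ 2 / (2 * β))) * Real.exp (-s) := by
  have h1 : ‖gE β ζ s‖ = Real.exp (-β * s ^ 2 / 2 - ζ.re * s) := by
    unfold gE
    rw [Complex.norm_exp]
    congr 1
    have : (-(β : ℂ) * (s : ℂ) ^ 2 / 2 - ζ * (s : ℂ)) = ((-β * s ^ 2 / 2 : ℝ) : ℂ) - ζ * (s : ℂ) := by
      push_cast; ring
    rw [this, Complex.sub_re, Complex.ofReal_re, Complex.re_mul_ofReal]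
  rw [norm_mul, h1, norm_pow, Complex.norm_real, Real.norm_of_nonneg hs]
  have h2 : s ^ n ≤ n.factorial * Real.exp s := by
    have := Real.pow_div_factorial_le_exp s hs n
    rwa [div_le_iff₀' (by positivity)] at this
  have h3 : s + (-β * s ^ 2 / 2 - ζ.re * s) ≤ (2 - ζ.re) ^ 2 / (2 * β) + -s := by
    have : (2 - ζ.re) ^ 2 / (2 * β) + -s - (s + (-β * s ^ 2 / 2 - ζ.re * s))
      = (β * s - (2 - ζ.re)) ^ 2 / (2 * β) := by
      field_simp; ring
    have h4 : 0 ≤ (β * s - (2 - ζ.re)) ^ 2 / (2 * β) := by positivity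
    linarith
  calc s ^ n * Real.exp (-β * s ^ 2 / 2 - ζ.re * s)
      ≤ (n.factorial * Real.exp s) * Real.exp (-β * s ^ 2 / 2 - ζ.re * s) := by gcongr
    _ = n.factorial * Real.exp (s + (-β * s ^ 2 / 2 - ζ.re * s)) := by rw [Real.exp_add]; ring
    _ ≤ n.factorial * Real.exp ((2 - ζ.re) ^ 2 / (2 * β) + -s) := by gcongr
    _ = _ := by rw [Real.exp_add]; ring

lemma gE_integrable (β : ℝ) (hβ : 0 < β) (ζ : ℂ) (n : ℕ) :
    IntegrableOn (fun s : ℝ => (s : ℂ) ^ n * gE β ζ s) (Set.Ioi 0) := by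
  refine Integrable.mono' ((integrableOn_exp_neg_Ioi 0).const_mul
    (n.factorial * Real.exp ((2 - ζ.re) ^ 2 / (2 * β)))) ?_ ?_
  · apply Continuous.aestronglyMeasurable
    unfold gE
    fun_prop
  · filter_upwards [ae_restrict_mem measurableSet_Ioi] with s hs
    exact gE_bound β hβ ζ n s (le_of_lt hs)

lemma gE_tendsto (β : ℝ) (hβ : 0 < β) (ζ : ℂ) (n : ℕ) :
    Filter.Tendsto (fun s : ℝ => (s : ℂ) ^ n * gE β ζ s) Filter.atTop (nhds 0) := by
  have h : Filter.Tendsto (fun s : ℝ =>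
      (n.factorial * Real.exp ((2 - ζ.re) ^ 2 / (2 * β))) * Real.exp (-s)) Filter.atTop (nhds 0) := by
    simpa using (Real.tendsto_exp_neg_atTop_nhds_zero).const_mul
      (n.factorial * Real.exp ((2 - ζ.re) ^ 2 / (2 * β)))
  refine squeeze_zero_norm' ?_ h
  filter_upwards [Filter.eventually_ge_atTop 0] with s hs
  exact gE_bound β hβ ζ n s hs

lemma gE_deriv (β : ℝ) (ζ : ℂ) (s : ℝ) :
    HasDerivAt (gE β ζ) ((-(β : ℂ) * s - ζ) * gE β ζ s) s := by
  have h0 : HasDerivAt (fun s : ℝ => (s : ℂ)) 1 s := Complex.ofRealCLM.hasDerivAt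
  have h1 := ((((h0.pow 2).const_mul (-(β : ℂ))).div_const 2).sub (h0.const_mul ζ)).cexp
  refine h1.congr_deriv ?_
  simp only [gE, Pi.pow_apply, Pi.sub_apply]
  push_cast
  ring

lemma gE_J (β : ℝ) (hβ : 0 < β) (ζ : ℂ) :
    ‖ζ ^ 2 * ∫ s in Set.Ioi (0 : ℝ), (s : ℂ) ^ 1 * gE β ζ s‖
      ≤ 1 + (3 * β + 6 * β ^ 2) * Real.exp ((2 - ζ.re) ^ 2 / (2 * β)) := by
  have i1 := gE_integrable β hβ ζ 1
  have i3 := gE_integrable β hβ ζ 3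
  have t0 := gE_tendsto β hβ ζ 0
  have t1 := gE_tendsto β hβ ζ 1
  have t2 := gE_tendsto β hβ ζ 2
  have iA : IntegrableOn (fun s : ℝ => (-3 * β : ℂ) * ((s : ℂ) ^ 1 * gE β ζ s)
      + (β : ℂ) ^ 2 * ((s : ℂ) ^ 3 * gE β ζ s)) (Set.Ioi 0) :=
    (i1.const_mul _).add (i3.const_mul _)
  have hd : ∀ s ∈ Set.Ici (0 : ℝ), HasDerivAt
      (fun s : ℝ => -((ζ * (s : ℂ) + 1 - β * (s : ℂ) ^ 2) * gE β ζ s))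
      (ζ ^ 2 * ((s : ℂ) ^ 1 * gE β ζ s) - ((-3 * β : ℂ) * ((s : ℂ) ^ 1 * gE β ζ s)
      + (β : ℂ) ^ 2 * ((s : ℂ) ^ 3 * gE β ζ s))) s := by
    intro s _
    have h0 : HasDerivAt (fun s : ℝ => (s : ℂ)) 1 s := Complex.ofRealCLM.hasDerivAt
    have h1 := ((((h0.const_mul ζ).add_const 1).sub ((h0.pow 2).const_mul (β : ℂ))).mul
      (gE_deriv β ζ s)).neg
    refine h1.congr_deriv ?_
    simp only [Pi.pow_apply, Pi.sub_apply]
    push_cast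
    ring
  have ht : Filter.Tendsto (fun s : ℝ => -((ζ * (s : ℂ) + 1 - β * (s : ℂ) ^ 2) * gE β ζ s))
      Filter.atTop (nhds 0) := by
    have := (((t1.const_mul ζ).add t0).sub (t2.const_mul (β : ℂ))).neg
    simp only [mul_zero, add_zero, sub_zero, neg_zero] at this
    refine this.congr fun s => ?_
    ring
  have key := integral_Ioi_of_hasDerivAt_of_tendsto' hd ((i1.const_mul (ζ ^ 2)).sub iA) ht
  rw [integral_sub (i1.const_mul (ζ ^ 2)) iA, integral_const_mul] at key
  have g0 : gE β ζ 0 = 1 := by simp [gE]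
  have key2 : ζ ^ 2 * ∫ s in Set.Ioi (0 : ℝ), (s : ℂ) ^ 1 * gE β ζ s
      = 1 + ∫ s in Set.Ioi (0 : ℝ), ((-3 * β : ℂ) * ((s : ℂ) ^ 1 * gE β ζ s)
      + (β : ℂ) ^ 2 * ((s : ℂ) ^ 3 * gE β ζ s)) := by
    rw [g0] at key
    simp only [Complex.ofReal_zero] at key
    linear_combination key
  rw [key2]
  refine (norm_add_le _ _).trans ?_
  rw [norm_one]
  gcongr
  set M := Real.exp ((2 - ζ.re) ^ 2 / (2 * β)) with hM
  have hb := norm_integral_le_of_norm_le (μ := volume.restrict (Set.Ioi (0:ℝ)))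
    (f := fun s : ℝ => (-3 * β : ℂ) * ((s : ℂ) ^ 1 * gE β ζ s)
      + (β : ℂ) ^ 2 * ((s : ℂ) ^ 3 * gE β ζ s))
    ((integrableOn_exp_neg_Ioi 0).const_mul ((3 * β + 6 * β ^ 2) * M)) (by
    filter_upwards [ae_restrict_mem measurableSet_Ioi] with s hs
    have b1 := gE_bound β hβ ζ 1 s (le_of_lt hs)
    have b3 := gE_bound β hβ ζ 3 s (le_of_lt hs)
    rw [← hM] at b1 b3
    refine (norm_add_le _ _).trans ?_
    rw [norm_mul (-3 * β : ℂ), norm_mul ((β : ℂ) ^ 2)]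
    have n1 : ‖(-3 * β : ℂ)‖ = 3 * β := by simp [abs_of_pos hβ]
    have n2 : ‖(β : ℂ) ^ 2‖ = β ^ 2 := by simp
    rw [n1, n2]
    have f3 : ((Nat.factorial 3 : ℕ) : ℝ) = 6 := by norm_num [Nat.factorial]
    have f1 : ((Nat.factorial 1 : ℕ) : ℝ) = 1 := by norm_num
    rw [f1] at b1
    rw [f3] at b3
    calc _ ≤ 3 * β * (1 * M * Real.exp (-s)) + β ^ 2 * (6 * M * Real.exp (-s)) := by gcongr
      _ = _ := by ring)
  rw [integral_const_mul, integral_exp_neg_Ioi_zero, mul_one] at hb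
  exact hb

/-- **Quadratic decay of the dispersion function along vertical lines**
(Lemma 2.1, inequality (2.5)). -/
theorem disp_quadratic_decay_on_vertical_lines
    (n₀ β ωp : ℝ) (hn : 0 < n₀) (hβ : 0 < β) (hω : 0 < ωp) :
    ∀ lam : ℝ, ∃ C > (0:ℝ), ∀ κ : ℝ, 0 < κ → ∀ ω : ℝ,
      0 < lam ^ 2 * κ ^ 2 + ω ^ 2 →
      ‖disp n₀ β ωp (((lam * κ : ℝ) : ℂ) + Complex.I * (ω : ℂ)) κ‖
        ≤ C / (lam ^ 2 * κ ^ 2 + ω ^ 2) := by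
  intro lam
  refine ⟨ωp ^ 2 * (1 + (3 * β + 6 * β ^ 2) * Real.exp ((2 - lam) ^ 2 / (2 * β))),
    by positivity, ?_⟩
  intro κ hκ ω hpos
  have hκ' : (κ : ℂ) ≠ 0 := by exact_mod_cast hκ.ne'
  have hn' : (n₀ : ℂ) ≠ 0 := by exact_mod_cast hn.ne'
  set ζ : ℂ := (((lam * κ : ℝ) : ℂ) + Complex.I * (ω : ℂ)) / (κ : ℂ) with hζ
  have hζ2 : ζ = (lam : ℂ) + ((ω / κ : ℝ) : ℂ) * Complex.I := by
    rw [hζ]; push_cast; field_simp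
  have hre : ζ.re = lam := by rw [hζ2]; simp
  have hnorm : κ ^ 2 * ‖ζ ^ 2‖ = lam ^ 2 * κ ^ 2 + ω ^ 2 := by
    rw [norm_pow, ← Complex.normSq_eq_norm_sq, hζ2, Complex.normSq_add_mul_I]
    field_simp
  have hJ := gE_J β hβ ζ
  rw [hre, norm_mul] at hJ
  have hdisp : disp n₀ β ωp (((lam * κ : ℝ) : ℂ) + Complex.I * (ω : ℂ)) κ
      = -((ωp : ℂ) ^ 2 / (κ : ℂ) ^ 2) * ∫ s in Set.Ioi (0 : ℝ), (s : ℂ) ^ 1 * gE β ζ s := by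
    unfold disp
    rw [← hζ]
    have : ∀ s : ℝ, ((s : ℝ) : ℂ) * ((Fmax n₀ β s : ℝ) : ℂ) * Complex.exp (-ζ * ((s : ℝ) : ℂ))
        = (n₀ : ℂ) * ((s : ℂ) ^ 1 * gE β ζ s) := by
      intro s
      unfold Fmax gE
      rw [sub_eq_add_neg, Complex.exp_add]
      push_cast
      rw [neg_mul ζ]
      ring
    simp_rw [this]
    rw [integral_const_mul]
    push_cast
    field_simp
  rw [hdisp, le_div_iff₀ hpos, ← hnorm, norm_mul, norm_neg, norm_div, norm_pow, norm_pow,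
    Complex.norm_real, Complex.norm_real, Real.norm_of_nonneg hκ.le, Real.norm_of_nonneg hω.le]
  set J := ‖∫ s in Set.Ioi (0 : ℝ), (s : ℂ) ^ 1 * gE β ζ s‖
  calc ωp ^ 2 / κ ^ 2 * J * (κ ^ 2 * ‖ζ ^ 2‖) = ωp ^ 2 * (‖ζ ^ 2‖ * J) := by
        field_simp
    _ ≤ _ := by gcongr
end

section
/- Asymptotic expansion of the dispersion function for |z| ≫ κ (Lemma 2.2): For every δ ∈ (0,1) there exist δ' > 0 and C > 0 such that for every κ > 0 and every z ∈ ℂ ∖ {0} with Re z > −min((1−δ)·|Im z|, δ'·κ), one has |𝓛(z,κ) + ω_p²/z² − 3·β·ω_p²·κ²/z⁴| ≤ C·ω_p²·κ⁴/|z|⁶. -/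
open MeasureTheory Complex

/-- The integrand `p(s) exp(-β s²/2) exp(-w s)`. -/
noncomputable def gI (β : ℝ) (w : ℂ) (p : Polynomial ℂ) (s : ℝ) : ℂ :=
  p.eval (s : ℂ) * (Complex.exp (-(β : ℂ) * (s : ℂ) ^ 2 / 2) * Complex.exp (-w * (s : ℂ)))

/-- The differential operator on polynomial prefactors of the Gaussian. -/
noncomputable def gD (β : ℝ) (p : Polynomial ℂ) : Polynomial ℂ :=
  Polynomial.derivative p - Polynomial.C (β : ℂ) * Polynomial.X * p

lemma gI_continuous (β : ℝ) (w : ℂ) (p : Polynomial ℂ) : Continuous (gI β w p) := by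
  unfold gI
  have : Continuous fun s : ℝ => p.eval (s : ℂ) := p.continuous.comp Complex.continuous_ofReal
  fun_prop

lemma gI_integrable (β : ℝ) (hβ : 0 < β) (w : ℂ) (p : Polynomial ℂ) :
    IntegrableOn (gI β w p) (Set.Ioi 0) := by
  induction p using Polynomial.induction_on' with
  | add p q hp hq =>
    have : gI β w (p + q) = fun s => gI β w p s + gI β w q s := by
      funext s; simp [gI, add_mul]
    rw [this]
    exact hp.add hq
  | monomial n a =>
    have h := (integrable_cexp_quadratic (b := ((β : ℂ) / 2)) (by simp; linarith)
      (1 - w) 0).norm.const_mul (‖a‖ * (n.factorial : ℝ))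
    refine Integrable.mono' h.integrableOn (gI_continuous β w _).aestronglyMeasurable ?_
    refine (ae_restrict_iff' measurableSet_Ioi).2 (Filter.Eventually.of_forall ?_)
    intro s hs
    have hs : 0 < s := hs
    have h1 : s ^ n ≤ n.factorial * Real.exp s := by
      have := Real.pow_div_factorial_le_exp s hs.le n
      rwa [div_le_iff₀ (by positivity), mul_comm] at this
    have e : ‖cexp (-((β : ℂ) / 2) * (s : ℂ) ^ 2 + (1 - w) * s + 0)‖ = Real.exp s *
        ‖Complex.exp (-(β : ℂ) * (s : ℂ) ^ 2 / 2) * Complex.exp (-w * (s : ℂ))‖ := by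
      rw [← Complex.norm_of_nonneg (Real.exp_pos s).le, ← norm_mul, Complex.ofReal_exp,
        ← Complex.exp_add, ← Complex.exp_add]
      congr 2
      ring
    rw [e, gI, norm_mul, Polynomial.eval_monomial, norm_mul, norm_pow,
      Complex.norm_of_nonneg hs.le]
    calc _ ≤ ‖a‖ * (n.factorial * Real.exp s) *
          ‖Complex.exp (-(β : ℂ) * (s : ℂ) ^ 2 / 2) * Complex.exp (-w * (s : ℂ))‖ := by
          gcongr
      _ = _ := by ring

lemma gI_step (β : ℝ) (hβ : 0 < β) (w : ℂ) (p : Polynomial ℂ) :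
    w * (∫ s in Set.Ioi (0 : ℝ), gI β w p s) =
      p.eval 0 + ∫ s in Set.Ioi (0 : ℝ), gI β w (gD β p) s := by
  have hd : ∀ s : ℝ, HasDerivAt (gI β w p) (gI β w (gD β p) s - w * gI β w p s) s := by
    intro s
    have h1 : HasDerivAt (fun z : ℂ => p.eval z * (Complex.exp (-(β : ℂ) * z ^ 2 / 2) *
        Complex.exp (-w * z))) (gI β w (gD β p) s - w * gI β w p s) (s : ℂ) := by
      have a1 := p.hasDerivAt (s : ℂ)
      have a2 : HasDerivAt (fun z : ℂ => -(β : ℂ) * z ^ 2 / 2) (-(β : ℂ) * s) (s : ℂ) := by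
        have := (((hasDerivAt_id (s : ℂ)).pow 2).const_mul (-(β : ℂ))).div_const 2
        refine this.congr_deriv ?_
        simp only [id]
        push_cast
        ring
      have a3 : HasDerivAt (fun z : ℂ => -w * z) (-w) (s : ℂ) := by
        simpa using (hasDerivAt_id (s : ℂ)).const_mul (-w)
      refine (a1.mul (a2.cexp.mul a3.cexp)).congr_deriv ?_
      simp [gI, gD]
      ring
    exact h1.comp_ofReal
  have hi := gI_integrable β hβ w p
  have hi' := gI_integrable β hβ w (gD β p)
  have hi2 : IntegrableOn (fun s => gI β w (gD β p) s - w * gI β w p s) (Set.Ioi 0) :=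
    hi'.sub (hi.const_mul w)
  have ht := tendsto_zero_of_hasDerivAt_of_integrableOn_Ioi (fun s _ => hd s) hi2 hi
  have := integral_Ioi_of_hasDerivAt_of_tendsto' (fun s _ => hd s) hi2 ht
  rw [integral_sub hi' (hi.const_mul w), integral_const_mul] at this
  have h0 : gI β w p 0 = p.eval 0 := by simp [gI]
  rw [h0] at this
  linear_combination -this

lemma gI_expansion (β : ℝ) (hβ : 0 < β) (w : ℂ) :
    w ^ 6 * (∫ s in Set.Ioi (0 : ℝ), gI β w Polynomial.X s) =
      w ^ 4 - 3 * β * w ^ 2 + 15 * β ^ 2 +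
      ∫ s in Set.Ioi (0 : ℝ), gI β w ((gD β)^[6] Polynomial.X) s := by
  have h0 := gI_step β hβ w Polynomial.X
  have h1 := gI_step β hβ w (gD β Polynomial.X)
  have h2 := gI_step β hβ w (gD β (gD β Polynomial.X))
  have h3 := gI_step β hβ w (gD β (gD β (gD β Polynomial.X)))
  have h4 := gI_step β hβ w (gD β (gD β (gD β (gD β Polynomial.X))))
  have h5 := gI_step β hβ w (gD β (gD β (gD β (gD β (gD β Polynomial.X)))))
  have e0 : (Polynomial.X : Polynomial ℂ).eval 0 = 0 := by simp
  have e1 : (gD β Polynomial.X).eval 0 = 1 := by simp [gD]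
  have e2 : (gD β (gD β Polynomial.X)).eval 0 = 0 := by simp [gD]
  have e3 : (gD β (gD β (gD β Polynomial.X))).eval 0 = -3 * β := by
    simp [gD]; ring
  have e4 : (gD β (gD β (gD β (gD β Polynomial.X)))).eval 0 = 0 := by
    simp [gD]
  have e5 : (gD β (gD β (gD β (gD β (gD β Polynomial.X))))).eval 0 = 15 * β ^ 2 := by
    simp [gD]; ring
  rw [e0] at h0
  rw [e1] at h1
  rw [e2] at h2
  rw [e3] at h3
  rw [e4] at h4
  rw [e5] at h5
  simp only [Function.iterate_succ, Function.iterate_zero, Function.comp, id]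
  linear_combination w ^ 5 * h0 + w ^ 4 * h1 + w ^ 3 * h2 + w ^ 2 * h3 + w * h4 + h5

lemma gI_bound (β : ℝ) (hβ : 0 < β) (w : ℂ) (hw : -1 < w.re) (p : Polynomial ℂ) :
    ‖∫ s in Set.Ioi (0 : ℝ), gI β w p s‖ ≤ ∫ s in Set.Ioi (0 : ℝ), ‖gI β (-1) p s‖ := by
  refine norm_integral_le_of_norm_le (gI_integrable β hβ (-1) p).norm ?_
  refine (ae_restrict_iff' measurableSet_Ioi).2 (Filter.Eventually.of_forall ?_)
  intro s hs
  have hs : 0 < s := hs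
  simp only [gI, norm_mul]
  gcongr ?_ * (_ * ?_)
  rw [Complex.norm_exp, Complex.norm_exp]
  apply Real.exp_le_exp.2
  simp
  nlinarith

/-- **Asymptotic expansion of the dispersion function for `|z| ≫ κ`** (Lemma 2.2). -/
theorem disp_asymptotic_expansion
    (n₀ β ωp : ℝ) (hn : 0 < n₀) (hβ : 0 < β) (hω : 0 < ωp) :
    ∀ δ ∈ Set.Ioo (0:ℝ) 1, ∃ δ' > (0:ℝ), ∃ C > (0:ℝ),
      ∀ κ : ℝ, 0 < κ → ∀ z : ℂ, z ≠ 0 →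
        -min ((1 - δ) * |z.im|) (δ' * κ) < z.re →
        ‖disp n₀ β ωp z κ + ((ωp ^ 2 : ℝ) : ℂ) / z ^ 2
            - ((3 * β * ωp ^ 2 * κ ^ 2 : ℝ) : ℂ) / z ^ 4‖
          ≤ C * ωp ^ 2 * κ ^ 4 / ‖z‖ ^ 6 := by
  intro δ _
  have hM : 0 ≤ ∫ s in Set.Ioi (0 : ℝ), ‖gI β (-1) ((gD β)^[6] Polynomial.X) s‖ :=
    integral_nonneg fun s => norm_nonneg _
  refine ⟨1, one_pos, 15 * β ^ 2 +
    ∫ s in Set.Ioi (0 : ℝ), ‖gI β (-1) ((gD β)^[6] Polynomial.X) s‖, by positivity, ?_⟩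
  intro κ hκ z hz hre
  have hκc : (κ : ℂ) ≠ 0 := by exact_mod_cast hκ.ne'
  have hnc : (n₀ : ℂ) ≠ 0 := by exact_mod_cast hn.ne'
  have hw : -1 < (z / (κ : ℂ)).re := by
    rw [Complex.div_ofReal_re, lt_div_iff₀ hκ]
    have := min_le_right ((1 - δ) * |z.im|) (1 * κ)
    linarith
  have hE := gI_expansion β hβ (z / κ)
  have hB := gI_bound β hβ (z / κ) hw ((gD β)^[6] Polynomial.X)
  generalize (∫ s in Set.Ioi (0 : ℝ), ‖gI β (-1) ((gD β)^[6] Polynomial.X) s‖) = M at *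
  generalize (∫ s in Set.Ioi (0 : ℝ), gI β (z / κ) ((gD β)^[6] Polynomial.X) s) = R at *
  have hI : (∫ s in Set.Ioi (0 : ℝ), ((s : ℝ) : ℂ) * ((Fmax n₀ β s : ℝ) : ℂ) *
      Complex.exp (-(z / (κ : ℂ)) * ((s : ℝ) : ℂ))) =
      n₀ * ∫ s in Set.Ioi (0 : ℝ), gI β (z / κ) Polynomial.X s := by
    rw [← integral_const_mul]
    congr 1
    funext s
    simp [gI, Fmax]
    ring
  have key : disp n₀ β ωp z κ + ((ωp ^ 2 : ℝ) : ℂ) / z ^ 2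
            - ((3 * β * ωp ^ 2 * κ ^ 2 : ℝ) : ℂ) / z ^ 4 =
      -((ωp : ℂ) ^ 2 * κ ^ 4 / z ^ 6 * (15 * β ^ 2 + R)) := by
    rw [disp, hI]
    generalize (∫ s in Set.Ioi (0 : ℝ), gI β (z / κ) Polynomial.X s) = G at *
    have hR : R = (z / κ) ^ 6 * G - ((z / κ) ^ 4 - 3 * β * (z / κ) ^ 2 + 15 * β ^ 2) := by
      linear_combination -hE
    rw [hR]
    push_cast
    field_simp
    ring
  rw [key, norm_neg, norm_mul, norm_div, norm_mul, norm_pow, norm_pow, norm_pow,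
    Complex.norm_of_nonneg hω.le, Complex.norm_of_nonneg hκ.le]
  have hn2 : ‖(15 * (β : ℂ) ^ 2 + R)‖ ≤ 15 * β ^ 2 + M := by
    refine (norm_add_le _ _).trans ?_
    have : ‖(15 * (β : ℂ) ^ 2)‖ = 15 * β ^ 2 := by
      simp
    rw [this]
    gcongr
  calc _ ≤ ωp ^ 2 * κ ^ 4 / ‖z‖ ^ 6 * (15 * β ^ 2 + M) := by gcongr
    _ = _ := by ring
end

section
/- Expansion of the z-derivative of the dispersion function (computation in the proof of Lemma 2.5): Define M(z,κ) := (w₀/κ³)·∫₀^∞ s²·F(s)·exp(−(z/κ)·s) ds (which equals ∂_z 𝓛(z,κ)). For every δ' > 0 there exists C > 0 such that for all κ > 0 and all z ∈ ℂ ∖ {0} with Re z ≥ −δ'·κ, one has |M(z,κ) − 2·ω_p²/z³| ≤ C·ω_p²·κ/|z|⁴. -/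
open MeasureTheory Complex

/-- `M(z,κ) = (w₀/κ³) ∫₀^∞ s² F(s) exp(−(z/κ) s) ds`, which equals `∂_z 𝓛(z,κ)`. -/
noncomputable def dispDeriv (n₀ β ωp : ℝ) (z : ℂ) (κ : ℝ) : ℂ :=
  ((ωp ^ 2 / n₀ : ℝ) : ℂ) / (κ : ℂ) ^ 3 *
    ∫ s in Set.Ioi (0 : ℝ),
      ((s : ℝ) : ℂ) ^ 2 * ((Fmax n₀ β s : ℝ) : ℂ) * Complex.exp (-(z / (κ : ℂ)) * ((s : ℝ) : ℂ))


/-- The weight `s^k exp(-β s²/2 - p s)`. -/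
noncomputable def momF (β : ℝ) (p : ℂ) (k : ℕ) (s : ℝ) : ℂ :=
  (s : ℂ) ^ k * Complex.exp (-(β / 2 : ℂ) * (s : ℂ) ^ 2 + (-p) * (s : ℂ) + 0)

lemma momF_norm (β : ℝ) (p : ℂ) (k : ℕ) (s : ℝ) (hs : 0 < s) :
    ‖momF β p k s‖ = s ^ k * Real.exp (-(β / 2) * s ^ 2 - p.re * s) := by
  unfold momF
  rw [norm_mul, norm_pow, Complex.norm_real, Real.norm_of_nonneg hs.le, Complex.norm_exp]
  congr 2
  have : (-(β / 2 : ℂ) * (s : ℂ) ^ 2 + (-p) * (s : ℂ) + 0)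
      = ((-(β / 2) * s ^ 2 : ℝ) : ℂ) - p * (s : ℂ) := by push_cast; ring
  rw [this, Complex.sub_re, Complex.ofReal_re, Complex.re_mul_ofReal]

lemma momF_cont (β : ℝ) (p : ℂ) (k : ℕ) : Continuous (momF β p k) := by
  unfold momF
  fun_prop

lemma momF_int (β : ℝ) (hβ : 0 < β) (p : ℂ) (k : ℕ) :
    IntegrableOn (momF β p k) (Set.Ioi 0) := by
  have h0 : Integrable (momF β (p - 1) 0) := by
    have := integrable_cexp_quadratic' (b := -(β / 2 : ℂ)) (by
      have : (-(β / 2 : ℂ)) = ((-(β / 2) : ℝ) : ℂ) := by push_cast; ring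
      rw [this, Complex.ofReal_re]; linarith) (-(p - 1)) 0
    unfold momF
    simpa using this
  have h1 : IntegrableOn (fun s => (k.factorial : ℝ) * ‖momF β (p - 1) 0 s‖) (Set.Ioi 0) :=
    (h0.norm.const_mul _).integrableOn
  refine Integrable.mono' h1 (momF_cont β p k).aestronglyMeasurable ?_
  refine (ae_restrict_iff' measurableSet_Ioi).2 (Filter.Eventually.of_forall fun s hs => ?_)
  have hs : 0 < s := hs
  rw [momF_norm _ _ _ _ hs, momF_norm _ _ _ _ hs]
  have h2 := Real.pow_div_factorial_le_exp s hs.le k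
  have hk : (0 : ℝ) < k.factorial := by exact_mod_cast k.factorial_pos
  rw [div_le_iff₀ hk] at h2
  have h3 : Real.exp (-(β / 2) * s ^ 2 - (p - 1).re * s)
      = Real.exp s * Real.exp (-(β / 2) * s ^ 2 - p.re * s) := by
    rw [← Real.exp_add]; congr 1; simp; ring
  rw [h3]
  have := mul_le_mul_of_nonneg_right h2 (Real.exp_pos (-(β / 2) * s ^ 2 - p.re * s)).le
  linarith

/-- Moments. -/
noncomputable def mom (β : ℝ) (p : ℂ) (k : ℕ) : ℂ := ∫ s in Set.Ioi (0 : ℝ), momF β p k s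

lemma momF_deriv (β : ℝ) (p : ℂ) (k : ℕ) (s : ℝ) :
    HasDerivAt (momF β p k)
      (k * momF β p (k - 1) s - β * momF β p (k + 1) s - p * momF β p k s) s := by
  have h1 : HasDerivAt (fun x : ℂ => x ^ k * Complex.exp (-(β / 2 : ℂ) * x ^ 2 + (-p) * x + 0))
      (k * momF β p (k - 1) s - β * momF β p (k + 1) s - p * momF β p k s) (s : ℂ) := by
    have h2 := (hasDerivAt_pow k (s : ℂ)).mul
      (((((hasDerivAt_pow 2 (s : ℂ)).const_mul (-(β / 2 : ℂ))).add
        ((hasDerivAt_id (s : ℂ)).const_mul (-p))).add_const 0).cexp)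
    refine h2.congr_deriv ?_
    simp [momF]
    ring
  exact h1.comp_ofReal

lemma mom_rec (β : ℝ) (hβ : 0 < β) (p : ℂ) (k : ℕ) :
    p * mom β p k = (if k = 0 then 1 else 0) + k * mom β p (k - 1) - β * mom β p (k + 1) := by
  have i1 := (momF_int β hβ p (k - 1)).const_mul (k : ℂ)
  have i2 := (momF_int β hβ p (k + 1)).const_mul (β : ℂ)
  have i3 := (momF_int β hβ p k).const_mul p
  have i4 := (i1.sub i2).sub i3
  have ht := tendsto_zero_of_hasDerivAt_of_integrableOn_Ioi (a := 0)
    (fun s _ => momF_deriv β p k s) i4 (momF_int β hβ p k)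
  have h := integral_Ioi_of_hasDerivAt_of_tendsto' (a := 0)
    (fun s _ => momF_deriv β p k s) i4 ht
  have i12 : Integrable (fun x => (k : ℂ) * momF β p (k - 1) x - β * momF β p (k + 1) x)
      (volume.restrict (Set.Ioi 0)) := i1.sub i2
  rw [integral_sub i12 i3, integral_sub i1 i2] at h
  simp only [integral_const_mul] at h
  have h0 : momF β p k 0 = if k = 0 then 1 else 0 := by
    by_cases hk : k = 0 <;> simp [momF, hk]
  rw [h0] at h
  unfold mom
  linear_combination -h

lemma mom_bound (β : ℝ) (hβ : 0 < β) (δ : ℝ) (p : ℂ) (hp : -δ ≤ p.re) (k : ℕ) :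
    ‖mom β p k‖ ≤ ∫ s in Set.Ioi (0 : ℝ), ‖momF β (-δ : ℂ) k s‖ := by
  unfold mom
  refine norm_integral_le_of_norm_le (momF_int β hβ _ k).norm ?_
  refine (ae_restrict_iff' measurableSet_Ioi).2 (Filter.Eventually.of_forall fun s hs => ?_)
  have hs : 0 < s := hs
  rw [momF_norm _ _ _ _ hs, momF_norm _ _ _ _ hs]
  have : -δ * s ≤ p.re * s := mul_le_mul_of_nonneg_right hp hs.le
  refine mul_le_mul_of_nonneg_left (Real.exp_le_exp.2 ?_) (by positivity)
  have h2 : (-(δ : ℂ)).re = -δ := by simp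
  rw [h2]
  linarith

lemma mom_two (β : ℝ) (hβ : 0 < β) (p : ℂ) :
    p ^ 4 * mom β p 2 - 2 * p = -12 * β * mom β p 0 + 39 * β ^ 2 * mom β p 2
      - 14 * β ^ 3 * mom β p 4 + β ^ 4 * mom β p 6 := by
  have r0 := mom_rec β hβ p 0
  have r1 := mom_rec β hβ p 1
  have r2 := mom_rec β hβ p 2
  have r3 := mom_rec β hβ p 3
  have r4 := mom_rec β hβ p 4
  have r5 := mom_rec β hβ p 5
  norm_num at r0 r1 r2 r3 r4 r5
  have e2 : p ^ 2 * mom β p 2 = 2 * mom β p 0 - 5 * β * mom β p 2 + β ^ 2 * mom β p 4 := by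
    linear_combination p * r2 + 2 * r1 - β * r3
  have e3 : p ^ 3 * mom β p 2 = 2 - 12 * β * mom β p 1 + 9 * β ^ 2 * mom β p 3
      - β ^ 3 * mom β p 5 := by
    linear_combination p * e2 + 2 * r0 - 5 * β * r2 + β ^ 2 * r4
  linear_combination p * e3 - 12 * β * r1 + 9 * β ^ 2 * r3 - β ^ 3 * r5

lemma dispDeriv_eq (n₀ β ωp : ℝ) (hn : 0 < n₀) (z : ℂ) (κ : ℝ) :
    dispDeriv n₀ β ωp z κ = (ωp : ℂ) ^ 2 / (κ : ℂ) ^ 3 * mom β (z / κ) 2 := by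
  have hn' : (n₀ : ℂ) ≠ 0 := by exact_mod_cast hn.ne'
  have : ∀ s : ℝ, ((s : ℝ) : ℂ) ^ 2 * ((Fmax n₀ β s : ℝ) : ℂ) *
      Complex.exp (-(z / (κ : ℂ)) * ((s : ℝ) : ℂ)) = n₀ * momF β (z / κ) 2 s := by
    intro s
    unfold Fmax momF
    push_cast
    rw [add_zero, Complex.exp_add]
    have : (-(β : ℂ) * (s : ℂ) ^ 2 / 2) = -(β / 2 : ℂ) * (s : ℂ) ^ 2 := by ring
    rw [this]; ring
  unfold dispDeriv mom
  simp only [this, integral_const_mul]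
  push_cast
  field_simp

/-- **Expansion of the z-derivative of the dispersion function**
(computation in the proof of Lemma 2.5). -/
theorem dispDeriv_expansion
    (n₀ β ωp : ℝ) (hn : 0 < n₀) (hβ : 0 < β) (hω : 0 < ωp) :
    ∀ δ' : ℝ, 0 < δ' → ∃ C > (0:ℝ),
      ∀ κ : ℝ, 0 < κ → ∀ z : ℂ, z ≠ 0 → -δ' * κ ≤ z.re →
        ‖dispDeriv n₀ β ωp z κ - ((2 * ωp ^ 2 : ℝ) : ℂ) / z ^ 3‖
          ≤ C * ωp ^ 2 * κ / ‖z‖ ^ 4 := by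
  intro δ hδ
  set A : ℕ → ℝ := fun k => ∫ s in Set.Ioi (0 : ℝ), ‖momF β (-δ : ℂ) k s‖ with hA
  have hA0 : ∀ k, 0 ≤ A k := fun k => integral_nonneg fun s => norm_nonneg _
  have h0 := hA0 0
  have h2 := hA0 2
  have h4 := hA0 4
  have h6 := hA0 6
  refine ⟨12 * β * A 0 + 39 * β ^ 2 * A 2 + 14 * β ^ 3 * A 4 + β ^ 4 * A 6 + 1,
    by positivity, ?_⟩
  intro κ hκ z hz hre
  have hκ' : (κ : ℂ) ≠ 0 := by exact_mod_cast hκ.ne'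
  set p : ℂ := z / κ with hp
  have hpre : -δ ≤ p.re := by
    rw [hp, Complex.div_ofReal_re, le_div_iff₀ hκ]; exact hre
  have hb : ∀ k, ‖mom β p k‖ ≤ A k := fun k => mom_bound β hβ δ p hpre k
  have key := mom_two β hβ p
  have heq : dispDeriv n₀ β ωp z κ - ((2 * ωp ^ 2 : ℝ) : ℂ) / z ^ 3
      = ((ωp ^ 2 * κ : ℝ) : ℂ) / z ^ 4 * (p ^ 4 * mom β p 2 - 2 * p) := by
    rw [dispDeriv_eq n₀ β ωp hn, ← hp, hp]
    push_cast
    field_simp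
  rw [heq, norm_mul, norm_div, norm_pow, Complex.norm_real, Real.norm_of_nonneg (by positivity),
    key]
  have hz4 : 0 ≤ ωp ^ 2 * κ / ‖z‖ ^ 4 := by positivity
  have hβn : ‖(β : ℂ)‖ = β := by rw [Complex.norm_real, Real.norm_of_nonneg hβ.le]
  have hbd : ‖-12 * β * mom β p 0 + 39 * β ^ 2 * mom β p 2
      - 14 * β ^ 3 * mom β p 4 + β ^ 4 * mom β p 6‖
      ≤ 12 * β * A 0 + 39 * β ^ 2 * A 2 + 14 * β ^ 3 * A 4 + β ^ 4 * A 6 + 1 := by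
    have t1 := norm_add_le (-12 * β * mom β p 0 + 39 * β ^ 2 * mom β p 2
      - 14 * β ^ 3 * mom β p 4) (β ^ 4 * mom β p 6)
    have t2 := norm_sub_le (-12 * β * mom β p 0 + 39 * β ^ 2 * mom β p 2)
      (14 * β ^ 3 * mom β p 4)
    have t3 := norm_add_le (-12 * β * mom β p 0) (39 * β ^ 2 * mom β p 2)
    simp only [norm_mul, norm_pow, norm_neg, hβn, Complex.norm_ofNat] at t1 t2 t3
    have u0 := mul_le_mul_of_nonneg_left (hb 0) (by positivity : 0 ≤ 12 * β)
    have u2 := mul_le_mul_of_nonneg_left (hb 2) (by positivity : 0 ≤ 39 * β ^ 2)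
    have u4 := mul_le_mul_of_nonneg_left (hb 4) (by positivity : 0 ≤ 14 * β ^ 3)
    have u6 := mul_le_mul_of_nonneg_left (hb 6) (by positivity : 0 ≤ β ^ 4)
    linarith
  have := mul_le_mul_of_nonneg_left hbd hz4
  refine this.trans (le_of_eq ?_)
  ring
end

section
/- Low-frequency resolvent lower bound away from the plasma frequencies (Lemma 2.4): For every ε > 0 there exist δ' > 0, ν₀ > 0 and c > 0 such that for all κ ∈ (0, ν₀) and all z ∈ ℂ with Re z > −δ'·κ, |z − i·ω_p| ≥ ε and |z + i·ω_p| ≥ ε, one has |1 − 𝓛(z,κ)| ≥ c. -/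
open MeasureTheory Complex

open Polynomial in
/-- Laplace transform of polynomial times Gaussian. -/
noncomputable def MM (β : ℝ) (p : ℂ[X]) (ζ : ℂ) : ℂ :=
  ∫ s in Set.Ioi (0:ℝ), p.eval (s:ℂ) * cexp (-((β/2 : ℝ) : ℂ) * (s:ℂ)^2 + (-ζ) * s + 0)

open Polynomial in
lemma MM_int (β : ℝ) (hβ : 0 < β) (p : ℂ[X]) (ζ : ℂ) :
    IntegrableOn (fun s : ℝ => p.eval (s:ℂ) * cexp (-((β/2 : ℝ) : ℂ) * (s:ℂ)^2 + (-ζ) * s + 0))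
      (Set.Ioi (0:ℝ)) := by
  induction p using Polynomial.induction_on' with
  | add p q hp hq =>
    simp only [eval_add, add_mul]
    exact hp.add hq
  | monomial n a =>
    have h1 : Integrable (fun s : ℝ => cexp (-((β/2 : ℝ) : ℂ) * (s:ℂ)^2 + (-ζ+1) * s + 0)) :=
      integrable_cexp_quadratic (by rw [Complex.ofReal_re]; positivity) _ _
    have h2 := (h1.norm.const_mul (‖a‖ * n.factorial)).integrableOn (s := Set.Ioi (0:ℝ))
    refine Integrable.mono' h2 ?_ ?_
    · exact (Continuous.aestronglyMeasurable (by simp only [eval_monomial]; fun_prop))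
    · filter_upwards [ae_restrict_mem measurableSet_Ioi] with s hs
      have hs : 0 < s := hs
      have h3 : cexp (-((β/2 : ℝ) : ℂ) * (s:ℂ)^2 + (-ζ+1) * s + 0)
        = ((Real.exp s : ℝ) : ℂ) * cexp (-((β/2 : ℝ) : ℂ) * (s:ℂ)^2 + (-ζ) * s + 0) := by
        rw [Complex.ofReal_exp, ← Complex.exp_add]; ring_nf
      rw [h3]
      simp only [eval_monomial, norm_mul, norm_pow, Complex.norm_real, Real.norm_eq_abs,
        abs_of_pos hs, Real.abs_exp]
      have h4 := Real.pow_div_factorial_le_exp s hs.le n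
      rw [div_le_iff₀ (by positivity)] at h4
      calc ‖a‖ * s ^ n * ‖cexp (-((β/2 : ℝ) : ℂ) * (s:ℂ)^2 + (-ζ) * s + 0)‖
          ≤ ‖a‖ * (Real.exp s * n.factorial) * ‖cexp (-((β/2 : ℝ) : ℂ) * (s:ℂ)^2 + (-ζ) * s + 0)‖ := by
            gcongr
        _ = _ := by ring

open Polynomial in
lemma MM_rec (β : ℝ) (hβ : 0 < β) (p : ℂ[X]) (ζ : ℂ) :
    ζ * MM β p ζ = p.eval 0 + MM β (derivative p - C (β:ℂ) * X * p) ζ := by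
  have hd : ∀ s : ℝ, HasDerivAt
      (fun s : ℝ => p.eval (s:ℂ) * cexp (-((β/2 : ℝ) : ℂ) * (s:ℂ)^2 + (-ζ) * s + 0))
      ((derivative p - C (β:ℂ) * X * p - C ζ * p).eval (s:ℂ) *
        cexp (-((β/2 : ℝ) : ℂ) * (s:ℂ)^2 + (-ζ) * s + 0)) s := by
    intro s
    have h1 : HasDerivAt (fun z : ℂ => p.eval z * cexp (-((β/2 : ℝ) : ℂ) * z^2 + (-ζ) * z + 0))
      ((derivative p).eval (s:ℂ) * cexp (-((β/2 : ℝ) : ℂ) * (s:ℂ)^2 + (-ζ) * s + 0) +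
       p.eval (s:ℂ) * (cexp (-((β/2 : ℝ) : ℂ) * (s:ℂ)^2 + (-ζ) * s + 0) *
        (-((β/2 : ℝ) : ℂ) * (2 * (s:ℂ)) + (-ζ)))) (s:ℂ) := by
      refine (p.hasDerivAt _).mul (HasDerivAt.cexp ?_)
      refine HasDerivAt.add_const _ (HasDerivAt.add ?_ ?_)
      · simpa using (hasDerivAt_pow 2 (s:ℂ)).const_mul (-((β/2 : ℝ) : ℂ))
      · exact hasDerivAt_const_mul (-ζ)
    refine h1.comp_ofReal.congr_deriv ?_
    simp only [eval_sub, eval_mul, eval_C, eval_X]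
    push_cast
    ring
  have ht := tendsto_zero_of_hasDerivAt_of_integrableOn_Ioi (a := 0) (fun s _ => hd s)
    (MM_int β hβ _ ζ) (MM_int β hβ p ζ)
  have hi := integral_Ioi_of_hasDerivAt_of_tendsto' (a := 0) (fun s _ => hd s)
    (MM_int β hβ _ ζ) ht
  have hs : (fun s : ℝ => (derivative p - C (β:ℂ) * X * p - C ζ * p).eval (s:ℂ) *
        cexp (-((β/2 : ℝ) : ℂ) * (s:ℂ)^2 + (-ζ) * s + 0)) = fun s : ℝ =>
      (derivative p - C (β:ℂ) * X * p).eval (s:ℂ) *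
        cexp (-((β/2 : ℝ) : ℂ) * (s:ℂ)^2 + (-ζ) * s + 0) -
      ζ * (p.eval (s:ℂ) * cexp (-((β/2 : ℝ) : ℂ) * (s:ℂ)^2 + (-ζ) * s + 0)) := by
    funext s
    simp only [eval_sub, eval_mul, eval_C]
    ring
  rw [hs, integral_sub (MM_int β hβ _ ζ) ((MM_int β hβ _ ζ).const_mul _),
    integral_const_mul] at hi
  change MM β _ ζ - ζ * MM β p ζ = _ at hi
  simp at hi
  linear_combination -hi

open Polynomial in
lemma MM_bound (β : ℝ) (hβ : 0 < β) (p : ℂ[X]) (R : ℝ) :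
    Integrable (fun s : ℝ => ‖p.eval (s:ℂ) * cexp (-((β/2 : ℝ) : ℂ) * (s:ℂ)^2 + (-(-R:ℂ)) * s + 0)‖)
      (volume.restrict (Set.Ioi (0:ℝ))) ∧
    ∀ ζ : ℂ, -R ≤ ζ.re → ∀ s ∈ Set.Ioi (0:ℝ),
    ‖p.eval (s:ℂ) * cexp (-((β/2 : ℝ) : ℂ) * (s:ℂ)^2 + (-ζ) * s + 0)‖ ≤
    ‖p.eval (s:ℂ) * cexp (-((β/2 : ℝ) : ℂ) * (s:ℂ)^2 + (-(-R:ℂ)) * s + 0)‖ := by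
  refine ⟨(MM_int β hβ p (-R)).norm, fun ζ hζ s hs => ?_⟩
  have hs : 0 < s := hs
  rw [norm_mul, norm_mul, Complex.norm_exp, Complex.norm_exp]
  refine mul_le_mul_of_nonneg_left (Real.exp_le_exp.2 ?_) (norm_nonneg _)
  simp [← Complex.ofReal_pow]
  nlinarith

open Polynomial in
lemma MM_le (β : ℝ) (hβ : 0 < β) (p : ℂ[X]) :
    ∃ C : ℝ, 0 < C ∧ ∀ ζ : ℂ, -1 ≤ ζ.re → ‖MM β p ζ‖ ≤ C := by
  obtain ⟨h1, h2⟩ := MM_bound β hβ p 1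
  refine ⟨(∫ s in Set.Ioi (0:ℝ), ‖p.eval (s:ℂ) * cexp (-((β/2 : ℝ) : ℂ) * (s:ℂ)^2 + (-(-(1:ℝ):ℂ)) * s + 0)‖) + 1, ?_, ?_⟩
  · have : 0 ≤ ∫ s in Set.Ioi (0:ℝ), ‖p.eval (s:ℂ) * cexp (-((β/2 : ℝ) : ℂ) * (s:ℂ)^2 + (-(-(1:ℝ):ℂ)) * s + 0)‖ := integral_nonneg (fun _ => norm_nonneg _)
    linarith
  · intro ζ hζ
    refine (norm_integral_le_of_norm_le h1 ?_).trans (by linarith)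
    filter_upwards [ae_restrict_mem measurableSet_Ioi] with s hs
    exact h2 ζ hζ s hs

open Polynomial in
lemma MM_cont (β : ℝ) (hβ : 0 < β) (p : ℂ[X]) : Continuous (MM β p) := by
  rw [continuous_iff_continuousAt]
  intro ζ₀
  obtain ⟨h1, h2⟩ := MM_bound β hβ p (1 - ζ₀.re)
  refine continuousAt_of_dominated (Filter.Eventually.of_forall fun ζ =>
    (MM_int β hβ p ζ).aestronglyMeasurable) ?_ h1 ?_
  · have : ∀ᶠ ζ : ℂ in nhds ζ₀, ζ₀.re - 1 < ζ.re :=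
      Complex.continuous_re.continuousAt.eventually_const_lt (by linarith)
    filter_upwards [this] with ζ hζ
    filter_upwards [ae_restrict_mem measurableSet_Ioi] with s hs
    exact h2 ζ (by linarith) s hs
  · exact Filter.Eventually.of_forall fun s => by fun_prop

open Polynomial in
lemma MM_asymp (β : ℝ) (hβ : 0 < β) :
    ∃ C : ℝ, 0 < C ∧ ∀ ζ : ℂ, -1 ≤ ζ.re → ‖ζ‖ * ‖ζ^2 * MM β X ζ - 1‖ ≤ C := by
  obtain ⟨K, hK, h⟩ := MM_le β hβ (derivative (derivative (derivative X - C (β:ℂ) * X * X) - C (β:ℂ) * X * (derivative X - C (β:ℂ) * X * X)) - C (β:ℂ) * X * (derivative (derivative X - C (β:ℂ) * X * X) - C (β:ℂ) * X * (derivative X - C (β:ℂ) * X * X)))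
  refine ⟨K, hK, fun ζ hζ => ?_⟩
  have e1 := MM_rec β hβ X ζ
  have e2 := MM_rec β hβ (derivative X - C (β:ℂ) * X * X) ζ
  have e3 := MM_rec β hβ (derivative (derivative X - C (β:ℂ) * X * X) - C (β:ℂ) * X * (derivative X - C (β:ℂ) * X * X)) ζ
  rw [← norm_mul]
  refine le_trans (le_of_eq ?_) (h ζ hζ)
  congr 1
  simp only [eval_sub, eval_mul, eval_X, eval_C, derivative_sub, derivative_mul, derivative_X, derivative_C, eval_add, derivative_one, eval_one, eval_zero, derivative_zero] at e1 e2 e3 ⊢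
  linear_combination ζ^2 * e1 + ζ * e2 + e3

lemma lap_int (w : ℂ) (hw : 0 < w.re) :
    IntegrableOn (fun s : ℝ => (s:ℂ) * cexp (-w * s)) (Set.Ioi (0:ℝ)) := by
  have h1 := integrableOn_exp_mul_complex_Ioi (a := -w + ((w.re/2 : ℝ) : ℂ))
    (by simp; linarith) 0
  refine Integrable.mono' (h1.norm.const_mul (2 / w.re))
    (Continuous.aestronglyMeasurable (by fun_prop)) ?_
  filter_upwards [ae_restrict_mem measurableSet_Ioi] with s hs
  have hs : 0 < s := hs
  rw [add_mul, Complex.exp_add, norm_mul, norm_mul, Complex.norm_real, Real.norm_eq_abs,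
    abs_of_pos hs, ← Complex.ofReal_mul, ← Complex.ofReal_exp, Complex.norm_real, Real.norm_eq_abs, Real.abs_exp]
  have h2 := Real.add_one_le_exp (w.re/2*s)
  have h3 : s ≤ 2 / w.re * Real.exp (w.re/2*s) := by
    rw [div_mul_eq_mul_div, le_div_iff₀ hw]; nlinarith
  calc s * ‖cexp (-w * s)‖ ≤ (2 / w.re * Real.exp (w.re/2*s)) * ‖cexp (-w * s)‖ := by gcongr
    _ = _ := by ring

lemma lap_eq (w : ℂ) (hw : 0 < w.re) :
    ∫ s in Set.Ioi (0:ℝ), (s:ℂ) * cexp (-w * s) = 1 / w ^ 2 := by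
  have hw0 : w ≠ 0 := by rintro rfl; simp at hw
  have h1 := integrableOn_exp_mul_complex_Ioi (a := -w) (by simpa using hw) 0
  have h2 := lap_int w hw
  have hd : ∀ s : ℝ, HasDerivAt (fun s : ℝ => -(1 / w) * ((s:ℂ) * cexp (-w * s)) + (-(1/w^2)) * cexp (-w * s))
      ((s:ℂ) * cexp (-w * s)) s := by
    intro s
    have e : HasDerivAt (fun z : ℂ => cexp (-w * z)) (cexp (-w * s) * (-w)) (s:ℂ) :=
      HasDerivAt.cexp (hasDerivAt_const_mul (-w))
    have e2 := (((hasDerivAt_id (s:ℂ)).mul e).const_mul (-(1/w))).add (e.const_mul (-(1/w^2)))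
    refine HasDerivAt.congr_deriv (f := fun s : ℝ => -(1 / w) * ((s:ℂ) * cexp (-w * s)) + (-(1/w^2)) * cexp (-w * s)) e2.comp_ofReal ?_
    simp only [id]
    field_simp
    ring
  have ht := tendsto_zero_of_hasDerivAt_of_integrableOn_Ioi (a := 0) (fun s _ => hd s) h2
    ((h2.const_mul _).add (h1.const_mul _))
  rw [integral_Ioi_of_hasDerivAt_of_tendsto' (a := 0) (fun s _ => hd s) h2 ht]
  simp

open Polynomial in
lemma MM_repr (β : ℝ) (hβ : 0 < β) (ζ : ℂ) (hζ : 0 < ζ.re) :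
    Integrable (fun v : ℝ => (1 / (ζ + I * v)^2) * cexp (-((1/(2*β) : ℝ) : ℂ) * (v:ℂ)^2)) ∧
    ((Real.pi : ℂ) / ((1/(2*β) : ℝ) : ℂ)) ^ (1 / 2 : ℂ) * MM β X ζ =
      ∫ v : ℝ, (1 / (ζ + I * v)^2) * cexp (-((1/(2*β) : ℝ) : ℂ) * (v:ℂ)^2) := by
  have hb : 0 < (((1/(2*β) : ℝ)) : ℂ).re := by rw [Complex.ofReal_re]; positivity
  have hg : Integrable (fun v : ℝ => cexp (-((1/(2*β) : ℝ) : ℂ) * (v:ℂ)^2)) := by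
    simpa using integrable_cexp_quadratic hb 0 0
  have hI : Integrable (Function.uncurry (fun (s v : ℝ) => ((s:ℂ) * cexp (-ζ * s)) *
      (cexp (I * (-s:ℂ) * v) * cexp (-((1/(2*β) : ℝ) : ℂ) * (v:ℂ)^2))))
      ((volume.restrict (Set.Ioi (0:ℝ))).prod volume) := by
    refine Integrable.mono ((lap_int ζ hζ).mul_prod hg)
      (Continuous.aestronglyMeasurable (by unfold Function.uncurry; fun_prop)) ?_
    refine Filter.Eventually.of_forall ?_
    rintro ⟨s, v⟩
    simp only [Function.uncurry, norm_mul]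
    have : ‖cexp (I * (-s:ℂ) * v)‖ = 1 := by
      rw [show I * (-s:ℂ) * v = ((-s*v : ℝ) : ℂ) * I by push_cast; ring]
      exact Complex.norm_exp_ofReal_mul_I _
    rw [this, one_mul]
  have hin : ∀ v : ℝ, ∫ s in Set.Ioi (0:ℝ), ((s:ℂ) * cexp (-ζ * s)) *
      (cexp (I * (-s:ℂ) * v) * cexp (-((1/(2*β) : ℝ) : ℂ) * (v:ℂ)^2)) =
      (1 / (ζ + I * v)^2) * cexp (-((1/(2*β) : ℝ) : ℂ) * (v:ℂ)^2) := by
    intro v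
    rw [← lap_eq (ζ + I * v) (by simpa using hζ), ← integral_mul_const]
    congr 1
    funext s
    rw [show -(ζ + I * v) * (s:ℂ) = -ζ * s + I * (-s:ℂ) * v by ring, Complex.exp_add]
    ring
  constructor
  · have := hI.integral_prod_right
    refine this.congr (Filter.Eventually.of_forall fun v => ?_)
    exact hin v
  · rw [← integral_congr_ae (Filter.Eventually.of_forall hin), ← integral_integral_swap hI, MM,
      ← integral_const_mul]
    congr 1
    funext s
    rw [integral_const_mul, fourierIntegral_gaussian hb]
    have hβ' : (β:ℂ) ≠ 0 := by exact_mod_cast hβ.ne'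
    rw [show -((β/2 : ℝ) : ℂ) * (s:ℂ)^2 + (-ζ) * s + 0 = -ζ * s + -(-(s:ℂ))^2 / (4 * ((1/(2*β) : ℝ) : ℂ)) by
      push_cast; field_simp; ring, Complex.exp_add, eval_X]
    ring

open Polynomial in
lemma MM_ne_interior (β : ℝ) (hβ : 0 < β) (ζ : ℂ) (hζ : 0 < ζ.re) (hy : ζ.im ≠ 0) :
    MM β X ζ ≠ 0 := by
  intro h0
  obtain ⟨hi, he⟩ := MM_repr β hβ ζ hζ
  rw [h0, mul_zero] at he
  set x := ζ.re with hx
  set y := ζ.im with hy'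
  let f : ℝ → ℝ := fun v => Real.exp (-(1/(2*β)) * v^2)
  let k : ℝ → ℝ := fun u => u / (x^2+u^2)^2
  have him : ∀ v : ℝ, ((1 / (ζ + I * v)^2) * cexp (-((1/(2*β) : ℝ) : ℂ) * (v:ℂ)^2)).im =
      (-2 * x) * (f v * k (v + y)) := by
    intro v
    have h1 : cexp (-((1/(2*β) : ℝ) : ℂ) * (v:ℂ)^2) = ((f v : ℝ) : ℂ) := by
      simp only [f]; push_cast; rfl
    rw [h1, Complex.im_mul_ofReal, one_div, Complex.inv_im, map_pow]
    have h2 : Complex.normSq (ζ + I * v) = x^2 + (v+y)^2 := by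
      rw [Complex.normSq_apply]; simp [← hx, ← hy']; ring
    have h3 : ((ζ + I * v)^2).im = 2 * x * (v + y) := by
      rw [pow_two, Complex.mul_im]; simp [← hx, ← hy']; ring
    rw [h2, h3]
    simp only [k]
    ring
  have hi1 : Integrable (fun v => f v * k (v + y)) := by
    have := (hi.im).const_mul (1 / (-2*x))
    refine this.congr (Filter.Eventually.of_forall fun v => ?_)
    have := him v
    simp only [RCLike.im_to_complex]
    rw [this]; field_simp
  have he1 : ∫ v, f v * k (v + y) = 0 := by
    have h1 : ∫ v : ℝ, ((1 / (ζ + I * v)^2) * cexp (-((1/(2*β) : ℝ) : ℂ) * (v:ℂ)^2)).im = 0 := by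
      have := integral_im hi
      simp only [RCLike.im_to_complex] at this
      rw [this, ← he]; simp
    simp_rw [him] at h1
    rw [integral_const_mul] at h1
    have : -2 * x ≠ 0 := by intro h; linarith
    exact (mul_eq_zero.1 h1).resolve_left this
  have hi2 : Integrable (fun u => f (u - y) * k u) := by
    simpa using hi1.comp_sub_right y
  have he2 : ∫ u, f (u - y) * k u = 0 := by
    rw [← he1, ← integral_sub_right_eq_self (fun v => f v * k (v + y)) y]
    simp
  have hneg : ∀ u, f (-u - y) * k (-u) = -(f (u + y) * k u) := by
    intro u
    simp only [f, k]
    rw [show (-u - y)^2 = (u+y)^2 by ring, neg_sq]; ring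
  have hi3 : Integrable (fun u => f (u + y) * k u) := by
    have := hi2.comp_neg.neg
    refine this.congr (Filter.Eventually.of_forall fun u => ?_)
    simp [hneg]
  have he3 : ∫ u, f (u + y) * k u = 0 := by
    have h := integral_neg_eq_self (fun u => f (u - y) * k u) volume
    simp only [hneg] at h
    rw [integral_neg, he2] at h
    linarith
  have hi4 : Integrable (fun u => y * (f (u - y) * k u - f (u + y) * k u)) :=
    (hi2.sub hi3).const_mul y
  have he4 : ∫ u, y * (f (u - y) * k u - f (u + y) * k u) = 0 := by
    rw [integral_const_mul, integral_sub hi2 hi3, he2, he3]; simp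
  have hpos : ∀ u, u ≠ 0 → 0 < y * (f (u - y) * k u - f (u + y) * k u) := by
    intro u hu
    have hD : 0 < (x^2+u^2)^2 := by positivity
    have e : y * (f (u - y) * k u - f (u + y) * k u) =
      (u * y) * (f (u-y) - f (u+y)) / (x^2+u^2)^2 := by simp only [k]; ring
    rw [e]
    apply div_pos _ hD
    have hc : 0 < 1/(2*β) := by positivity
    rcases lt_or_gt_of_ne (mul_ne_zero hu hy) with h | h
    · apply mul_pos_of_neg_of_neg h
      rw [sub_neg]
      exact Real.exp_lt_exp.2 (by nlinarith)
    · apply mul_pos h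
      rw [sub_pos]
      exact Real.exp_lt_exp.2 (by nlinarith)
  have := (integral_pos_iff_support_of_nonneg (fun u => ?_) hi4).2 ?_
  · rw [he4] at this; exact lt_irrefl _ this
  · by_cases hu : u = 0
    · subst hu; simp [k]
    · exact (hpos u hu).le
  · have hsub : Set.Ioi (0:ℝ) ⊆ Function.support (fun u => y * (f (u - y) * k u - f (u + y) * k u)) :=
      fun u hu => (hpos u (ne_of_gt hu)).ne'
    exact lt_of_lt_of_le (by simp) (measure_mono hsub)

open Polynomial in
lemma MM_ne_real (β : ℝ) (hβ : 0 < β) (ζ : ℂ) (hy : ζ.im = 0) :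
    MM β X ζ ≠ 0 := by
  have hz : ζ = ((ζ.re : ℝ) : ℂ) := by apply Complex.ext <;> simp [hy]
  have hre : ∀ s : ℝ, (X : ℂ[X]).eval (s:ℂ) * cexp (-((β/2 : ℝ) : ℂ) * (s:ℂ)^2 + (-ζ) * s + 0) =
     ((s * Real.exp (-(β/2) * s^2 + (-ζ.re) * s + 0) : ℝ) : ℂ) := by
    intro s
    rw [hz, eval_X]; push_cast; simp
  have hi := MM_int β hβ X ζ
  intro h0
  unfold MM at h0
  simp only [hre] at h0 hi
  rw [integral_complex_ofReal] at h0
  have h0 := Complex.ofReal_eq_zero.1 h0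
  have hi' := hi.re
  simp only [RCLike.re_to_complex, Complex.ofReal_re] at hi'
  have := (setIntegral_pos_iff_support_of_nonneg_ae ?_ hi').2 ?_
  · rw [h0] at this; exact lt_irrefl _ this
  · filter_upwards [ae_restrict_mem measurableSet_Ioi] with s hs
    have hs : 0 < s := hs
    simp only [Pi.zero_apply]; positivity
  · have hsub : Set.Ioi (0:ℝ) ⊆ Function.support (fun s : ℝ => s * Real.exp (-(β/2) * s^2 + (-ζ.re) * s + 0)) ∩ Set.Ioi 0 := by
      intro s hs
      have hs' : 0 < s := hs
      exact ⟨by rw [Function.mem_support]; positivity, hs⟩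
    exact lt_of_lt_of_le (by simp) (measure_mono hsub)

open Polynomial in
lemma MM_conj (β : ℝ) (ζ : ℂ) : MM β X ((starRingEnd ℂ) ζ) = (starRingEnd ℂ) (MM β X ζ) := by
  unfold MM
  rw [← integral_conj]
  congr 1
  funext s
  simp only [eval_X, map_mul, Complex.conj_ofReal, ← Complex.exp_conj, map_add, map_neg, map_pow, map_zero]

open Polynomial in
lemma MM_ne_imag (β : ℝ) (hβ : 0 < β) (ζ : ℂ) (hx : ζ.re = 0) (hy : ζ.im ≠ 0) :
    MM β X ζ ≠ 0 := by
  intro h0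
  have hc : (starRingEnd ℂ) ζ = -ζ := by apply Complex.ext <;> simp [hx]
  have h1 : MM β X (-ζ) = 0 := by rw [← hc, MM_conj, h0, map_zero]
  have hp : (derivative (1:ℂ[X]) - C (β:ℂ) * X * 1) = C (-β:ℂ) * X := by simp
  have hlin : ∀ w, MM β (C (-β:ℂ) * X) w = -β * MM β X w := by
    intro w
    unfold MM
    rw [← integral_const_mul]
    congr 1; funext s
    simp only [eval_mul, eval_C]; ring
  have e1 := MM_rec β hβ 1 ζ
  have e2 := MM_rec β hβ 1 (-ζ)
  rw [hp, hlin, h0] at e1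
  rw [hp, hlin, h1] at e2
  have hz : ζ ≠ 0 := by rintro rfl; simp at hy
  have hs : MM β 1 ζ + MM β 1 (-ζ) = 0 := by
    have : ζ * (MM β 1 ζ + MM β 1 (-ζ)) = 0 := by linear_combination e1 - e2
    exact (mul_eq_zero.1 this).resolve_left hz
  have hb : (-((β/2 : ℝ) : ℂ)).re < 0 := by rw [Complex.neg_re, Complex.ofReal_re]; linarith
  have hq := integral_cexp_quadratic hb (-ζ) 0
  have hqi := integrable_cexp_quadratic' hb (-ζ) 0
  rw [← intervalIntegral.integral_Iic_add_Ioi (b := 0) hqi.integrableOn hqi.integrableOn] at hq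
  have hr : ∫ s in Set.Iic (0:ℝ), cexp (-((β/2 : ℝ) : ℂ) * (s:ℂ)^2 + (-ζ) * s + 0) = MM β 1 (-ζ) := by
    have := integral_comp_neg_Ioi (0:ℝ) (fun s : ℝ => cexp (-((β/2 : ℝ) : ℂ) * (s:ℂ)^2 + (-ζ) * s + 0))
    rw [neg_zero] at this
    rw [← this]
    unfold MM
    congr 1; funext s
    simp
  have hr2 : ∫ s in Set.Ioi (0:ℝ), cexp (-((β/2 : ℝ) : ℂ) * (s:ℂ)^2 + (-ζ) * s + 0) = MM β 1 ζ := by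
    unfold MM; simp
  rw [hr, hr2, add_comm, hs] at hq
  have hβ' : (β:ℂ) ≠ 0 := by exact_mod_cast hβ.ne'
  have hpi : (Real.pi:ℂ) ≠ 0 := by exact_mod_cast Real.pi_ne_zero
  have := mul_eq_zero.1 hq.symm
  simp [Complex.exp_ne_zero, Complex.cpow_eq_zero_iff, hβ', hpi] at this

open Polynomial in
lemma MM_ne (β : ℝ) (hβ : 0 < β) (ζ : ℂ) (hx : 0 ≤ ζ.re) : MM β X ζ ≠ 0 := by
  by_cases hy : ζ.im = 0
  · exact MM_ne_real β hβ ζ hy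
  · rcases hx.eq_or_lt with h | h
    · exact MM_ne_imag β hβ ζ h.symm hy
    · exact MM_ne_interior β hβ ζ h hy

open Polynomial in
lemma MM_lower (β : ℝ) (hβ : 0 < β) (R : ℝ) (hR : 0 < R) :
    ∃ δ : ℝ, 0 < δ ∧ δ ≤ 1 ∧ ∃ c : ℝ, 0 < c ∧ ∀ ζ : ℂ, -δ < ζ.re → ‖ζ‖ ≤ R → c ≤ ‖MM β X ζ‖ := by
  have hcont := MM_cont β hβ X
  have hK : IsCompact (Metric.closedBall (0:ℂ) R ∩ {ζ : ℂ | 0 ≤ ζ.re}) :=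
    (isCompact_closedBall _ _).inter_right (isClosed_le continuous_const Complex.continuous_re)
  obtain ⟨z₀, hz₀, hmin⟩ := hK.exists_isMinOn ⟨0, by simp [hR.le]⟩ hcont.norm.continuousOn
  have hm : 0 < ‖MM β X z₀‖ := norm_pos_iff.2 (MM_ne β hβ z₀ hz₀.2)
  have hU := (isCompact_closedBall (0:ℂ) R).uniformContinuousOn_of_continuous hcont.continuousOn
  rw [Metric.uniformContinuousOn_iff] at hU
  obtain ⟨d, hd, hU⟩ := hU (‖MM β X z₀‖ / 2) (by linarith)
  refine ⟨min d 1, by positivity, min_le_right _ _, ‖MM β X z₀‖ / 2, by linarith, fun ζ h1 h2 => ?_⟩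
  have h3 : -d < ζ.re := by have := min_le_left d 1; linarith
  by_cases h : 0 ≤ ζ.re
  · have := hmin (a := ζ) ⟨by simpa using h2, h⟩
    simp only [Set.mem_ofPred_eq] at this
    linarith
  · push Not at h
    have hn : ‖(ζ.im : ℂ) * I‖ ≤ R := by
      simp only [norm_mul, Complex.norm_real, Complex.norm_I, mul_one, Real.norm_eq_abs]
      exact (Complex.abs_im_le_norm ζ).trans h2
    have hdist : dist ζ ((ζ.im : ℂ) * I) < d := by
      rw [dist_eq_norm]
      have : ζ - (ζ.im : ℂ) * I = ((ζ.re : ℝ) : ℂ) := by apply Complex.ext <;> simp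
      rw [this, Complex.norm_real, Real.norm_eq_abs, abs_of_neg h]; linarith
    have h4 := hU ζ (by simpa using h2) _ (by rw [mem_closedBall_zero_iff]; exact hn) hdist
    have h5 := hmin (a := (ζ.im : ℂ) * I) ⟨by rw [mem_closedBall_zero_iff]; exact hn, by simp⟩
    simp only [Set.mem_ofPred_eq] at h5
    rw [dist_eq_norm, norm_sub_rev] at h4
    have h6 := norm_sub_norm_le (MM β X ((ζ.im : ℂ) * I)) (MM β X ζ)
    linarith

open Polynomial in
lemma disp_eq (n₀ β ωp : ℝ) (hn : 0 < n₀) (z : ℂ) (κ : ℝ) :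
    1 - disp n₀ β ωp z κ = 1 + (ωp:ℂ)^2 / (κ:ℂ)^2 * MM β X (z / κ) := by
  have hn' : (n₀:ℂ) ≠ 0 := by exact_mod_cast hn.ne'
  have : ∫ s in Set.Ioi (0 : ℝ),
      ((s : ℝ) : ℂ) * ((Fmax n₀ β s : ℝ) : ℂ) * Complex.exp (-(z / (κ : ℂ)) * ((s : ℝ) : ℂ)) =
      n₀ * MM β X (z / κ) := by
    unfold MM
    rw [← integral_const_mul]
    congr 1; funext s
    rw [eval_X, add_zero, Complex.exp_add]
    unfold Fmax
    push_cast
    rw [show -(β:ℂ) * (s:ℂ)^2 / 2 = -(β/2:ℂ) * (s:ℂ)^2 by ring]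
    ring
  unfold disp
  rw [this]
  push_cast
  field_simp
  ring

/-- **Low-frequency resolvent lower bound away from the plasma frequencies** (Lemma 2.4). -/
theorem low_frequency_resolvent_lower_bound
    (n₀ β ωp : ℝ) (hn : 0 < n₀) (hβ : 0 < β) (hω : 0 < ωp) :
    ∀ ε : ℝ, 0 < ε → ∃ δ' > (0:ℝ), ∃ ν₀ > (0:ℝ), ∃ c > (0:ℝ),
      ∀ κ ∈ Set.Ioo (0:ℝ) ν₀, ∀ z : ℂ,
        -δ' * κ < z.re →
        ε ≤ ‖z - Complex.I * (ωp : ℂ)‖ →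
        ε ≤ ‖z + Complex.I * (ωp : ℂ)‖ →
        c ≤ ‖1 - disp n₀ β ωp z κ‖ := by
  intro ε hε
  obtain ⟨K, hK, hasy⟩ := MM_asymp β hβ
  obtain ⟨η, hη, hη1, hη2⟩ : ∃ η : ℝ, 0 < η ∧ η ≤ 1/2 ∧ η ≤ ε / (2 * ωp) :=
    ⟨min (1/2) (ε / (2 * ωp)), by positivity, min_le_left _ _, min_le_right _ _⟩
  obtain ⟨δ, hδ, hδ1, c₀, hc₀, hlow⟩ := MM_lower β hβ (K / η) (by positivity)
  refine ⟨δ, hδ, ωp * Real.sqrt (c₀ / 2), by positivity, min 1 (min (1/4) (ε / (4 * ωp))),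
    by positivity, ?_⟩
  rintro κ ⟨hκ, hκν⟩ z hz hm hp
  have hκ' : (κ:ℂ) ≠ 0 := by exact_mod_cast hκ.ne'
  rw [disp_eq n₀ β ωp hn]
  set ζ : ℂ := z / κ with hζ
  have hzζ : z = κ * ζ := by rw [hζ]; field_simp
  have hre : -δ < ζ.re := by
    have : z.re = κ * ζ.re := by rw [hzζ]; simp
    rw [this] at hz
    nlinarith
  set G := MM β Polynomial.X ζ with hG
  by_cases hbig : ‖ζ‖ ≤ K / η
  · refine (min_le_left _ _).trans ?_
    have h1 := hlow ζ hre hbig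
    have hκ2 : κ ^ 2 ≤ ωp ^ 2 * (c₀ / 2) := by
      have := pow_le_pow_left₀ hκ.le hκν.le 2
      rwa [mul_pow, Real.sq_sqrt (by positivity)] at this
    have h2 : 2 ≤ ‖(ωp:ℂ)^2 / (κ:ℂ)^2 * G‖ := by
      rw [norm_mul, norm_div, norm_pow, norm_pow, Complex.norm_real, Complex.norm_real,
        Real.norm_eq_abs, Real.norm_eq_abs, abs_of_pos hω, abs_of_pos hκ, div_mul_eq_mul_div,
        le_div_iff₀ (by positivity)]
      have : ωp^2 * c₀ ≤ ωp^2 * ‖G‖ := by gcongr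
      linarith
    have h3 := norm_sub_norm_le ((ωp:ℂ)^2 / (κ:ℂ)^2 * G) (-1)
    rw [sub_neg_eq_add, add_comm _ (1:ℂ), norm_neg, norm_one] at h3
    linarith
  · refine (min_le_right _ _).trans ?_
    push Not at hbig
    have hζpos : 0 < ‖ζ‖ := lt_trans (by positivity) hbig
    have hr : ‖ζ^2 * G - 1‖ ≤ η := by
      have h1 := hasy ζ (by linarith)
      rw [div_lt_iff₀ hη] at hbig
      by_contra hcon
      push Not at hcon
      have : ‖ζ‖ * η < ‖ζ‖ * ‖ζ^2 * G - 1‖ := by gcongr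
      linarith
    have hNpos : 0 < ‖z‖ := by
      rw [hzζ, norm_mul, Complex.norm_real, Real.norm_eq_abs, abs_of_pos hκ]; positivity
    have hid : z^2 * (1 + (ωp:ℂ)^2 / (κ:ℂ)^2 * G) = (z^2 + (ωp:ℂ)^2) + (ωp:ℂ)^2 * (ζ^2 * G - 1) := by
      rw [hzζ]; field_simp; ring
    have hω2 : ‖(ωp:ℂ)^2‖ = ωp^2 := by
      rw [norm_pow, Complex.norm_real, Real.norm_eq_abs, abs_of_pos hω]
    have hmain : ‖z^2 + (ωp:ℂ)^2‖ - ωp^2 * η ≤ ‖z‖^2 * ‖1 + (ωp:ℂ)^2 / (κ:ℂ)^2 * G‖ := by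
      rw [← norm_pow, ← norm_mul, hid]
      have h1 := norm_sub_norm_le (z^2 + (ωp:ℂ)^2) (-((ωp:ℂ)^2 * (ζ^2 * G - 1)))
      rw [sub_neg_eq_add, norm_neg, norm_mul, hω2] at h1
      have : ωp^2 * ‖ζ^2 * G - 1‖ ≤ ωp^2 * η := by gcongr
      linarith
    set A := ‖1 + (ωp:ℂ)^2 / (κ:ℂ)^2 * G‖ with hA
    have hA0 : 0 ≤ A := norm_nonneg _
    by_cases hN : ‖z‖^2 ≤ 2 * ωp^2
    · refine (min_le_right _ _).trans ?_
      have hfac : z^2 + (ωp:ℂ)^2 = (z - I * ωp) * (z + I * ωp) := by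
        linear_combination (ωp:ℂ)^2 * Complex.I_sq
      have hsum : 2 * ωp ≤ ‖z - I * ωp‖ + ‖z + I * ωp‖ := by
        have h1 := norm_sub_le (z + I * ωp) (z - I * ωp)
        have h2 : z + I * ωp - (z - I * ωp) = I * ((2 * ωp : ℝ) : ℂ) := by push_cast; ring
        rw [h2, norm_mul, Complex.norm_I, Complex.norm_real, Real.norm_eq_abs, one_mul,
          abs_of_pos (by positivity)] at h1
        linarith
      have hprod : ε * ωp ≤ ‖z^2 + (ωp:ℂ)^2‖ := by
        rw [hfac, norm_mul]
        rcases le_total ωp ‖z - I * ωp‖ with h | h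
        · nlinarith
        · have : ωp ≤ ‖z + I * ωp‖ := by linarith
          nlinarith
      have h5 : ωp^2 * η ≤ ε * ωp / 2 := by
        calc ωp^2 * η ≤ ωp^2 * (ε / (2 * ωp)) := by gcongr
          _ = ε * ωp / 2 := by field_simp
      have h6 : ε * ωp / 2 ≤ 2 * ωp^2 * A := by
        have : ‖z‖^2 * A ≤ 2 * ωp^2 * A := by gcongr
        linarith
      rw [div_le_iff₀ (by positivity)]
      nlinarith
    · refine (min_le_left _ _).trans ?_
      push Not at hN
      have h1 := norm_sub_norm_le (z^2) (-(ωp:ℂ)^2)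
      rw [sub_neg_eq_add, norm_neg, hω2, norm_pow] at h1
      have h2 : ωp^2 * η ≤ ωp^2 * (1/2) := by gcongr
      have h3 : ‖z‖^2 * (1/4) ≤ ‖z‖^2 * A := by nlinarith
      exact le_of_mul_le_mul_left h3 (by positivity)
end

section
/- Explicit Plemelj / Landau-damping formula for the imaginary part of the dispersion function on the imaginary axis (used in Subcase 2.1 of the proof of Lemma 2.4): For every κ > 0 and every ω ∈ ℝ, Im 𝓛(i·ω, κ) = (ω_p²·ω/(2·β·κ³))·√(2π/β)·exp(−ω²/(2·β·κ²)). In particular Im 𝓛(i·ω,κ) has the sign of ω and is nonzero for ω ≠ 0. -/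
open MeasureTheory Complex

lemma aux_cos (b a : ℝ) (hb : 0 < b) :
    ∫ s : ℝ, Real.exp (-b * s ^ 2) * Real.cos (a * s) =
      Real.sqrt (Real.pi / b) * Real.exp (-a ^ 2 / (4 * b)) := by
  have h := fourierIntegral_gaussian (b := (b : ℂ)) (by simpa using hb) (a : ℂ)
  have hi : Integrable (fun x : ℝ => cexp (I * (a : ℂ) * x) * cexp (-(b : ℂ) * x ^ 2)) := by
    have := (integrable_cexp_neg_mul_sq (b := (b : ℂ)) (by simpa using hb)).bdd_mul
      (f := fun x : ℝ => cexp (I * (a : ℂ) * x)) (c := 1)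
      (by fun_prop) (Filter.Eventually.of_forall fun x => by
        simp [Complex.norm_exp])
    exact this
  have h2 := congrArg Complex.re h
  have h3 := integral_re hi
  simp only [RCLike.re_to_complex] at h3
  rw [← h3] at h2
  have e : ∀ x : ℝ, (cexp (I * (a : ℂ) * x) * cexp (-(b : ℂ) * x ^ 2)).re =
      Real.exp (-b * x ^ 2) * Real.cos (a * x) := by
    intro x
    rw [← Complex.exp_add, Complex.exp_re]
    simp [← Complex.ofReal_pow]
  simp only [e] at h2
  rw [h2]
  have hs : ((Real.pi : ℂ) / (b : ℂ)) ^ (1 / 2 : ℂ) = ((Real.sqrt (Real.pi / b) : ℝ) : ℂ) := by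
    rw [Real.sqrt_eq_rpow, Complex.ofReal_cpow (by positivity)]
    push_cast
    rfl
  have he : cexp (-(a : ℂ) ^ 2 / (4 * (b : ℂ))) = ((Real.exp (-a ^ 2 / (4 * b)) : ℝ) : ℂ) := by
    push_cast
    rfl
  rw [hs, he, ← Complex.ofReal_mul, Complex.ofReal_re]

lemma aux_int_sin (b a : ℝ) (hb : 0 < b) :
    Integrable (fun s : ℝ => s * Real.exp (-b * s ^ 2) * Real.sin (a * s)) :=
  (integrable_mul_exp_neg_mul_sq hb).mul_bdd (c := 1) (by fun_prop)
    (Filter.Eventually.of_forall fun x => by simpa using Real.abs_sin_le_one _)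

lemma aux_sin (b a : ℝ) (hb : 0 < b) :
    ∫ s : ℝ, s * Real.exp (-b * s ^ 2) * Real.sin (a * s) =
      a / (2 * b) * (Real.sqrt (Real.pi / b) * Real.exp (-a ^ 2 / (4 * b))) := by
  have h1 := aux_int_sin b a hb
  have h2 : Integrable (fun s : ℝ => Real.exp (-b * s ^ 2) * Real.cos (a * s)) :=
    (integrable_exp_neg_mul_sq hb).mul_bdd (c := 1) (by fun_prop)
      (Filter.Eventually.of_forall fun x => by simpa using Real.abs_cos_le_one _)
  have h3 : Integrable (fun s : ℝ => Real.exp (-b * s ^ 2) * Real.sin (a * s)) :=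
    (integrable_exp_neg_mul_sq hb).mul_bdd (c := 1) (by fun_prop)
      (Filter.Eventually.of_forall fun x => by simpa using Real.abs_sin_le_one _)
  have hd : ∀ s : ℝ, HasDerivAt (fun s : ℝ => Real.exp (-b * s ^ 2) * Real.sin (a * s))
      (a * (Real.exp (-b * s ^ 2) * Real.cos (a * s)) -
        (2 * b) * (s * Real.exp (-b * s ^ 2) * Real.sin (a * s))) s := by
    intro s
    have u := (((hasDerivAt_id s).pow 2).const_mul (-b)).exp
    have v := ((hasDerivAt_id s).const_mul a).sin
    refine (u.mul v).congr_deriv ?_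
    simp only [Pi.pow_apply, id_eq]
    push_cast
    ring
  have h0 := integral_eq_zero_of_hasDerivAt_of_integrable hd
    ((h2.const_mul a).sub (h1.const_mul (2 * b))) h3
  rw [integral_sub (h2.const_mul a) (h1.const_mul (2 * b)), integral_const_mul,
    integral_const_mul, aux_cos b a hb] at h0
  generalize (∫ s : ℝ, s * Real.exp (-b * s ^ 2) * Real.sin (a * s)) = J at h0 ⊢
  generalize Real.sqrt (Real.pi / b) * Real.exp (-a ^ 2 / (4 * b)) = K at h0 ⊢
  field_simp
  linarith

lemma aux_half (b a : ℝ) (hb : 0 < b) :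
    ∫ s in Set.Ioi (0 : ℝ), s * Real.exp (-b * s ^ 2) * Real.sin (a * s) =
      a / (4 * b) * (Real.sqrt (Real.pi / b) * Real.exp (-a ^ 2 / (4 * b))) := by
  have h := integral_comp_abs (f := fun s : ℝ => s * Real.exp (-b * s ^ 2) * Real.sin (a * s))
  have e : ∀ s : ℝ, |s| * Real.exp (-b * |s| ^ 2) * Real.sin (a * |s|) =
      s * Real.exp (-b * s ^ 2) * Real.sin (a * s) := by
    intro s
    rcases abs_choice s with h | h <;> rw [h]
    simp
  simp only [e] at h
  rw [aux_sin b a hb] at h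
  have : a / (2 * b) = 2 * (a / (4 * b)) := by field_simp; norm_num
  rw [this] at h
  linarith

/-- **Explicit Plemelj / Landau-damping formula for the imaginary part of the dispersion
function on the imaginary axis** (used in Subcase 2.1 of the proof of Lemma 2.4). -/
theorem disp_imaginary_part_on_imaginary_axis
    (n₀ β ωp : ℝ) (hn : 0 < n₀) (hβ : 0 < β) (hω : 0 < ωp) :
    ∀ κ : ℝ, 0 < κ → ∀ ω : ℝ,
      (disp n₀ β ωp (Complex.I * (ω : ℂ)) κ).im =
        (ωp ^ 2 * ω / (2 * β * κ ^ 3)) * Real.sqrt (2 * Real.pi / β) *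
          Real.exp (-ω ^ 2 / (2 * β * κ ^ 2)) := by
  intro κ hκ ω
  have e : ∀ s : ℝ, ((s : ℝ) : ℂ) * ((Fmax n₀ β s : ℝ) : ℂ) *
      Complex.exp (-(Complex.I * (ω : ℂ) / (κ : ℂ)) * ((s : ℝ) : ℂ)) =
      ((n₀ * (s * Real.exp (-(β / 2) * s ^ 2)) : ℝ) : ℂ) *
        Complex.exp (((-(ω / κ * s) : ℝ) : ℂ) * Complex.I) := by
    intro s
    unfold Fmax
    rw [show -β * s ^ 2 / 2 = -(β / 2) * s ^ 2 by ring]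
    rw [show -(Complex.I * (ω : ℂ) / (κ : ℂ)) * ((s : ℝ) : ℂ) =
      ((-(ω / κ * s) : ℝ) : ℂ) * Complex.I by push_cast; ring]
    push_cast
    ring
  have hb : 0 < β / 2 := by positivity
  have hi : Integrable (fun s : ℝ => ((n₀ * (s * Real.exp (-(β / 2) * s ^ 2)) : ℝ) : ℂ) *
        Complex.exp (((-(ω / κ * s) : ℝ) : ℂ) * Complex.I)) :=
    (((integrable_mul_exp_neg_mul_sq hb).const_mul n₀).ofReal).mul_bdd (c := 1) (by fun_prop)
      (Filter.Eventually.of_forall fun x => by rw [Complex.norm_exp_ofReal_mul_I])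
  have h3 := integral_im (hi.restrict (s := Set.Ioi (0 : ℝ)))
  simp only [RCLike.im_to_complex, Complex.im_ofReal_mul, Complex.exp_ofReal_mul_I_im,
    Real.sin_neg] at h3
  have h4 : ∫ s in Set.Ioi (0 : ℝ), n₀ * (s * Real.exp (-(β / 2) * s ^ 2)) *
      -Real.sin (ω / κ * s) = -n₀ * (ω / κ / (4 * (β / 2)) *
        (Real.sqrt (Real.pi / (β / 2)) * Real.exp (-(ω / κ) ^ 2 / (4 * (β / 2))))) := by
    rw [← aux_half (β / 2) (ω / κ) hb, ← integral_const_mul]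
    congr 1
    ext s
    ring
  rw [h4] at h3
  unfold disp
  simp only [e]
  rw [show -(((ωp ^ 2 / n₀ : ℝ) : ℂ) / (κ : ℂ) ^ 2) = ((-(ωp ^ 2 / n₀ / κ ^ 2) : ℝ) : ℂ) by
    push_cast; ring, Complex.im_ofReal_mul, ← h3]
  rw [show Real.pi / (β / 2) = 2 * Real.pi / β by field_simp,
    show -(ω / κ) ^ 2 / (4 * (β / 2)) = -ω ^ 2 / (2 * β * κ ^ 2) by field_simp; norm_num]
  generalize Real.sqrt (2 * Real.pi / β) = A
  generalize Real.exp (-ω ^ 2 / (2 * β * κ ^ 2)) = B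
  field_simp
  norm_num
end
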